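/- For all integers n ≥ 1, Z_l(n,1) = Z_r(n,1). -/

import Mathlib

open scoped BigOperators

/-- The Pochhammer symbol `(x)_k = x (x+1) ⋯ (x+k-1)` for a real `x`. -/
noncomputable def poch (x : ℝ) (k : ℕ) : ℝ := ∏ i ∈ Finset.range k, (x + i)

/-- The rational function `R_{n,m}(t)` from the paper. -/
noncomputable def R (n m : ℕ) (t : ℝ) : ℝ :=
  (-1 : ℝ) ^ m * (t + n / 2) * (poch (t - n) m / m.factorial) *
    (poch (t - 2 * n + m) (2 * n - m) / (2 * n - m).factorial) *
    (poch (t + n + 1) n / poch t (n + 1)) *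
    (poch (t + n + 1) (2 * n - m) / poch t (2 * n - m + 1)) *
    ((n.factorial : ℝ) / poch t (n + 1)) ^ 2

/-- The rational function `R̃_{n,m}(t)` from the paper. -/
noncomputable def Rtilde (n m : ℕ) (t : ℝ) : ℝ :=
  ((n.factorial : ℝ) * poch (t - n) (2 * n - m) / (poch t (n + 1) * poch t (2 * n - m + 1))) *
    ∑ j ∈ Finset.range (n + 1),
      (n.choose j : ℝ) ^ 2 * ((2 * n - m + j).choose n : ℝ) * poch (t - j) n / n.factorial

/-- `Z_l(n,m) = -(1/3) Σ_{ν=n-m+1}^∞ (d/dt R_{n,m}(t))|_{t=ν}`. -/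
noncomputable def Zl (n m : ℕ) : ℝ :=
  -(1 / 3) * ∑' ν : ℕ, deriv (R n m) ((n : ℝ) - m + 1 + ν)

/-- `Z_r(n,m) = (1/6) Σ_{ν=1}^∞ (d²/dt² R̃_{n,m}(t))|_{t=ν}`. -/
noncomputable def Zr (n m : ℕ) : ℝ :=
  (1 / 6) * ∑' ν : ℕ, deriv (deriv (Rtilde n m)) (1 + (ν : ℝ))

/-- `U_k(n) = Σ_{i=0}^n C(4i,2i) / ((2i+1)^k C(2i,i)^8)`. -/
noncomputable def U (k n : ℕ) : ℝ :=
  ∑ i ∈ Finset.range (n + 1),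
    ((4 * i).choose (2 * i) : ℝ) / ((2 * i + 1) ^ k * ((2 * i).choose i : ℝ) ^ 8)

/-- The harmonic number `S₁(N) = Σ_{i=1}^N 1/i`. -/
noncomputable def S1 (N : ℕ) : ℝ := ∑ i ∈ Finset.range N, (1 : ℝ) / (i + 1)

/-- Coefficient of `rightT m t` in the formula for `rightT (m + 1) t`, where `n = m + 1`. -/
noncomputable def upX (n t : ℝ) : ℝ :=
  -6 * (3 * n + 2) * (3 * n + 1) * (n + 1) ^ 2 * n ^ 2 * (2 * n + 1)
    + (n + 1) * n * (((((216) * n + 333) * n + 172) * n + 33) * n + 2) * t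
    - ((((((171) * n + 210) * n + 45) * n - 30) * n - 14) * n - 2) * t ^ 2
    - (((((85) * n + 145) * n + 90) * n + 25) * n + 3) * t ^ 3

/-- Coefficient of `t ^ 2 * rightT m (t + 1)` in the formula for `rightT (m + 1) t`, where
`n = m + 1`. -/
noncomputable def upY (n t : ℝ) : ℝ :=
  ((((((86) * n + 65) * n - 45) * n - 55) * n - 17) * n - 2) + (((((85) * n + 145) * n + 90) * n
      + 25) * n + 3) * t

/-- Numerator of the inhomogeneous term of the recurrence. -/
noncomputable def rightNum (n : ℝ) : ℝ :=
  ((((((((1820) * n + 6219) * n + 9173) * n + 7661) * n + 3993) * n + 1344) * n + 288) * n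
      + 36) * n + 2

/-- Telescoping certificate for `Rtilde`, coefficient of `rightT m t`. -/
noncomputable def certA1 (n t : ℝ) : ℝ :=
  -(2 * n ^ 4 * ((((((((((87808) * n + 358744) * n + 659595) * n + 717643) * n + 508963) * n
      + 243273) * n + 77976) * n + 16074) * n + 1926) * n + 102)
    + n ^ 3 * ((((((((((171712) * n + 602488) * n + 942259) * n + 876639) * n + 543799) * n
        + 234921) * n + 69936) * n + 13494) * n + 1490) * n + 70) * t
    + 4 * n ^ 2 * ((((((((((33912) * n + 96648) * n + 104166) * n + 43729) * n - 7601) * n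
        - 16579) * n - 8012) * n - 2029) * n - 281) * n - 17) * t ^ 2
    + 2 * n * ((((((((((64024) * n + 197246) * n + 240688) * n + 135882) * n + 18696) * n
        - 20785) * n - 13881) * n - 3991) * n - 587) * n - 36) * t ^ 3
    + 1 * ((((((((((65484) * n + 224459) * n + 324598) * n + 255020) * n + 115272) * n
        + 27671) * n + 1560) * n - 916) * n - 234) * n - 18) * t ^ 4
    + 1 * (((((((((11452) * n + 41895) * n + 66193) * n + 59091) * n + 32707) * n + 11550) * n
        + 2554) * n + 324) * n + 18) * t ^ 5)

/-- Telescoping certificate for `Rtilde`, coefficient of `t ^ 2 * rightT m (t + 1)`. -/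
noncomputable def certB1 (n t : ℝ) : ℝ :=
  -((-2) * (n - 1) * n ^ 2 * (((((((((22124) * n + 79113) * n + 121957) * n + 105970) * n
      + 56931) * n + 19464) * n + 4164) * n + 513) * n + 28)
    + (-n) * ((((((((((86828) * n + 267767) * n + 325900) * n + 180864) * n + 19780) * n
        - 32743) * n - 20948) * n - 5986) * n - 880) * n - 54) * t
    + (-1) * ((((((((((54032) * n + 182564) * n + 258405) * n + 195929) * n + 82565) * n
        + 16121) * n - 994) * n - 1240) * n - 252) * n - 18) * t ^ 2
    + (-1) * (((((((((11452) * n + 41895) * n + 66193) * n + 59091) * n + 32707) * n + 11550) * n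
        + 2554) * n + 324) * n + 18) * t ^ 3)

/-- Telescoping certificate for the auxiliary function, coefficient of `rightT m t`. -/
noncomputable def certA2 (n t : ℝ) : ℝ :=
  -((-2) * n ^ 2 * (n + 1) ^ 3 * ((((((((5376) * n + 10016) * n + 3020) * n - 6633) * n
      - 7482) * n - 3348) * n - 714) * n - 60)
    + n * (n + 1) ^ 2 * (((((((((14592) * n + 9376) * n - 48364) * n - 91675) * n - 70833) * n
        - 28630) * n - 6166) * n - 630) * n - 20) * t
    + (-4) * (n + 1) * ((((((((((1152) * n - 11592) * n - 39960) * n - 50334) * n - 31963) * n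
        - 10614) * n - 1487) * n + 91) * n + 54) * n + 5) * t ^ 2
    + (-2) * ((((((((((12000) * n + 57920) * n + 102166) * n + 85136) * n + 30486) * n
        - 2592) * n - 6497) * n - 2469) * n - 431) * n - 31) * t ^ 3
    + 1 * (((((((((12336) * n + 18768) * n - 11071) * n - 44930) * n - 43228) * n - 21342) * n
        - 6013) * n - 936) * n - 64) * t ^ 4
    + 1 * ((((((((6384) * n + 19984) * n + 26433) * n + 19219) * n + 8361) * n + 2203) * n
        + 330) * n + 22) * t ^ 5)

/-- Telescoping certificate for the auxiliary function, coefficient of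
`t ^ 2 * rightT m (t + 1)`. -/
noncomputable def certB2 (n t : ℝ) : ℝ :=
  -(2 * (n - 1) * (n + 1) * (((((((((3408) * n + 7432) * n + 3761) * n - 3684) * n - 5770) * n
      - 3245) * n - 955) * n - 149) * n - 10)
    + 1 * ((((((((((7248) * n + 36064) * n + 51523) * n + 13136) * n - 35112) * n - 41374) * n
        - 21317) * n - 6028) * n - 926) * n - 62) * t
    + (-1) * (((((((((5952) * n - 1216) * n - 37504) * n - 64149) * n - 51589) * n - 23545) * n
        - 6343) * n - 958) * n - 64) * t ^ 2
    + (-1) * ((((((((6384) * n + 19984) * n + 26433) * n + 19219) * n + 8361) * n + 2203) * n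
        + 330) * n + 22) * t ^ 3)

/-- Middle coefficient of the three-term recurrence of `rightT` in `t`. -/
noncomputable def recP1 (n t : ℝ) : ℝ :=
  -2 * t ^ 3 - (4 * n + 2) * t ^ 2 + (n ^ 2 - 3 * n - 1) * t - n * (2 * n ^ 2 + n + 1)

/-- Telescoping certificate for `R`. -/
noncomputable def leftS (n t : ℝ) : ℝ :=
  (-2) * n ^ 4 * (2 * n + 1) * ((((((283) * n + 620) * n + 552) * n + 254) * n + 61) * n + 6)
    + (-1) * n ^ 3 * (((((((1724) * n + 4031) * n + 3745) * n + 1775) * n + 463) * n + 66) * n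
        + 4) * t
    + n ^ 3 * ((((((71) * n + 350) * n + 715) * n + 620) * n + 228) * n + 28) * t ^ 2
    + n ^ 2 * ((((((1555) * n + 3315) * n + 3000) * n + 1475) * n + 387) * n + 40) * t ^ 3
    + 5 * n * ((((((205) * n + 414) * n + 349) * n + 160) * n + 40) * n + 4) * t ^ 4
    + 1 * ((((((205) * n + 414) * n + 349) * n + 160) * n + 40) * n + 4) * t ^ 5

/-- Summation certificate for the formula expressing `rightT (m + 1)` through `rightT m`. -/
noncomputable def upCert (n t j : ℝ) : ℝ :=
  (n + 1) ^ 2 * ((((((86) * n + 65) * n - 45) * n - 55) * n - 17) * n - 2) - (n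
      + 1) * ((((((119) * n + 70) * n - 95) * n - 95) * n - 28) * n - 3) * t
    + (2 * (n + 1) * ((((((16) * n + 85) * n + 115) * n + 65) * n + 17) * n + 2)
        - 2 * ((((((19) * n + 134) * n + 191) * n + 109) * n + 28) * n + 3) * t) * j
    + ((((((85) * n + 145) * n + 90) * n + 25) * n + 3) * t - (n + 1) * (((((46) * n + 81) * n
        + 52) * n + 15) * n + 2)) * j ^ 2

theorem up_cert_identity (n t j : ℝ) :
    4 * (n + 1) ^ 3 * n ^ 2 * (2 * n + 1) ^ 2 *
        ((2 * n + 1 + j) * (2 * n + j) * (t - j) * (t - j + n))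
      - upX n t * (n + 1 - j) ^ 2 * (n + j) * (t - j)
      - t ^ 2 * upY n t * (n + 1 - j) ^ 2 * (n + j) * (t - j + n)
    = (n + 1 - j) ^ 2 * (2 * n + j) * (t - j) * upCert n t (j + 1)
      - j ^ 2 * (n + j) * (t - j + n) * upCert n t j := by
  unfold upX upY upCert
  ring

theorem left_cert_identity (n t : ℝ) :
    2 * (n + 1) ^ 5 * n ^ 3 *
        ((t + (n + 1) / 2) * (t - n - 1) * (t + 2 * n + 2) * (t - 2 * n) * (t - 2 * n - 1)
          * (t + 3 * n) * (t + 3 * n + 1) * (t + 3 * n + 2))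
      + 64 * n ^ 3 * (2 * n + 1) ^ 5 * ((t + n / 2) * (t - n) * (t + 2 * n) * (t + n + 1) ^ 5)
    = leftS n (t + 1) * (t + 3 * n) * t ^ 5 - leftS n t * (t - 2 * n) * (t + n + 1) ^ 5 := by
  unfold leftS
  ring

theorem right_cert_identity_one_zero (n t : ℝ) :
    2 * n ^ 2 * (2 * n + 1) ^ 3 * (n + 1) * (t - n - 1) * (t + n - 1) * (t + n) * (t - n) * upX n t
      + 128 * n ^ 3 * (2 * n + 1) ^ 9
        * ((t - n) * (t + n + 1) * (t + 2 * n) * (t + 2 * n + 1) * (t + n))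
      - n ^ 3 * rightNum n * ((12 * n - 5) * t + n * (12 * n - 7))
        * (t + n + 1) * (t + 2 * n) * (t + 2 * n + 1) * (t + n)
    = -t ^ 4 * (t + n - 1) * certB1 n (t + 1) * (t + 3 * n)
      - certA1 n t * (t - n) * (t + n + 1) * (t + 2 * n + 1) * (t + n) := by
  unfold upX rightNum certA1 certB1
  ring

theorem right_cert_identity_one_one (n t : ℝ) :
    2 * n ^ 2 * (2 * n + 1) ^ 3 * (n + 1) * (t - n - 1) * (t + n - 1) * (t - n) * (t + n) * upY n t
    = (t + n - 1) * (certA1 n (t + 1) * (t + n) - certB1 n (t + 1) * recP1 n t)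
      - certB1 n t * (t - n) * (t + n + 1) * (t + 2 * n + 1) * (t + n) := by
  unfold upY certA1 certB1 recP1
  ring

theorem right_cert_identity_two_zero (n t : ℝ) :
    2 * (2 * n + 1) ^ 3 * (n + 1) * (t + n - 1) * (t + n) * (t - n)
        * ((12 * n + 7) * t + (n + 1) * (12 * n + 5)) * upX n t
      + n ^ 5 * (n + 1) ^ 3 * (4 * n + 1) * (4 * n + 3) * ((12 * n - 5) * t + n * (12 * n - 7))
        * ((t + n + 1) * (t + 2 * n) * (t + 2 * n + 1) * (t + n))
    = -t ^ 4 * (t + n - 1) * certB2 n (t + 1) * (t + 3 * n)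
      - certA2 n t * (t - n) * (t + n + 1) * (t + 2 * n + 1) * (t + n) := by
  unfold upX certA2 certB2
  ring

theorem right_cert_identity_two_one (n t : ℝ) :
    2 * (2 * n + 1) ^ 3 * (n + 1) * (t + n - 1) * (t - n) * (t + n)
        * ((12 * n + 7) * t + (n + 1) * (12 * n + 5)) * upY n t
    = (t + n - 1) * (certA2 n (t + 1) * (t + n) - certB2 n (t + 1) * recP1 n t)
      - certB2 n t * (t - n) * (t + n + 1) * (t + 2 * n + 1) * (t + n) := by
  unfold upY certA2 certB2 recP1
  ring

theorem poch_succ_right (x : ℝ) (k : ℕ) : poch x (k + 1) = poch x k * (x + k) := by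
  simp [poch, Finset.prod_range_succ]

theorem poch_succ_left (x : ℝ) (k : ℕ) : poch x (k + 1) = x * poch (x + 1) k := by
  simp only [poch, Finset.prod_range_succ']
  rw [mul_comm]
  congr 1
  · simp
  · exact Finset.prod_congr rfl fun i _ => by push_cast; ring

theorem poch_add (x : ℝ) (k l : ℕ) : poch x (k + l) = poch x k * poch (x + k) l := by
  simp only [poch, Finset.prod_range_add]
  congr 1
  exact Finset.prod_congr rfl fun i _ => by push_cast; ring

theorem mul_poch_add_one (x : ℝ) (k : ℕ) : x * poch (x + 1) k = poch x k * (x + k) := by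
  rw [← poch_succ_left, poch_succ_right]

theorem poch_pos {x : ℝ} (hx : 0 < x) (k : ℕ) : 0 < poch x k :=
  Finset.prod_pos fun i _ => by positivity

theorem choose_succ_mul_cast (n j : ℕ) :
    (n.choose (j + 1) : ℝ) * (j + 1) = n.choose j * (n - j) := by
  rcases le_or_gt j n with h | h
  · have := Nat.choose_succ_right_eq n j
    have h2 : ((n.choose (j + 1) * (j + 1) : ℕ) : ℝ) = ((n.choose j * (n - j) : ℕ) : ℝ) := by
      rw [this]
    push_cast [Nat.cast_sub h] at h2
    exact h2
  · simp [Nat.choose_eq_zero_of_lt h, Nat.choose_eq_zero_of_lt (Nat.lt_succ_of_lt h)]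

theorem choose_mul_succ_cast (a k : ℕ) :
    ((a + k).choose k : ℝ) * (a + k + 1) = (a + k + 1).choose k * (a + 1) := by
  have := Nat.choose_mul_succ_eq (a + k) k
  rw [show a + k + 1 - k = a + 1 by omega] at this
  exact_mod_cast this

/-- The polynomial factor of `Rtilde (m + 1) 1`. -/
noncomputable def rightT (m : ℕ) (t : ℝ) : ℝ :=
  ∑ j ∈ Finset.range (m + 2), ((m + 1).choose j : ℝ) ^ 2 * ((2 * m + 1 + j).choose (m + 1) : ℝ)
    * poch (t - j) (m + 1) / (m + 1).factorial

theorem rightT_coeff_succ (m j : ℕ) :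
    ((j : ℝ) + 1) ^ 2 * (m + 1 + j) *
      (((m + 1).choose (j + 1) : ℝ) ^ 2 * ((2 * m + 2 + j).choose (m + 1) : ℝ))
    = ((m : ℝ) + 1 - j) ^ 2 * (2 * (m + 1) + j) *
      (((m + 1).choose j : ℝ) ^ 2 * ((2 * m + 1 + j).choose (m + 1) : ℝ)) := by
  have h1 := choose_succ_mul_cast (m + 1) j
  have h2 := choose_mul_succ_cast (m + j) (m + 1)
  rw [show m + j + (m + 1) = 2 * m + 1 + j by ring,
    show 2 * m + 1 + j + 1 = 2 * m + 2 + j by ring] at h2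
  push_cast at h1 h2
  generalize ((m + 1).choose (j + 1) : ℝ) = a at *
  generalize ((m + 1).choose j : ℝ) = b at *
  generalize ((2 * m + 2 + j).choose (m + 1) : ℝ) = c at *
  generalize ((2 * m + 1 + j).choose (m + 1) : ℝ) = d at *
  calc _ = (a * (j + 1)) ^ 2 * (c * (m + j + 1)) := by ring
    _ = _ := by rw [h1, ← h2]; ring

theorem rightT_rec (m : ℕ) (t : ℝ) :
    (t + 1) ^ 2 * (t + (m + 1)) * rightT m (t + 2) + recP1 (m + 1) t * rightT m (t + 1)
      + t ^ 2 * (t + 3 * (m + 1)) * rightT m t = 0 := by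
  set G : ℕ → ℝ := fun j => -((m : ℝ) + 1) * ((j : ℝ) ^ 2 * (m + j) *
      (((m + 1).choose j : ℝ) ^ 2 * ((2 * m + 1 + j).choose (m + 1) : ℝ))
      * poch (t - j + 2) m) / (m + 1).factorial with hG
  have key : ∑ j ∈ Finset.range (m + 2), (G (j + 1) - G j) = 0 := by
    rw [Finset.sum_range_sub]
    simp [hG]
  rw [← key]
  simp only [rightT, Finset.mul_sum, ← Finset.sum_add_distrib]
  refine Finset.sum_congr rfl fun j _ => ?_
  have hc := rightT_coeff_succ m j
  simp only [hG]
  rw [show 2 * m + 1 + (j + 1) = 2 * m + 2 + j by ring]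
  push_cast
  rw [show t - ((j : ℝ) + 1) + 2 = t - j + 1 by ring, show t + 2 - (j : ℝ) = t - j + 2 by ring,
    show t + 1 - (j : ℝ) = t - j + 1 by ring]
  have e1 : poch (t - j) (m + 1) = (t - j) * poch (t - j + 1) m := poch_succ_left _ _
  have e2 : poch (t - j + 1) (m + 1) = (t - j + 1) * poch (t - j + 2) m := by
    rw [poch_succ_left]; ring_nf
  have e3 : poch (t - j + 2) (m + 1) = poch (t - j + 2) m * (t - j + 2 + m) := poch_succ_right _ _
  have e4 : (t - j + 1) * poch (t - j + 2) m = poch (t - j + 1) m * (t - j + 1 + m) := by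
    rw [← e2, poch_succ_right]
  rw [e1, e2, e3]
  generalize poch (t - j + 1) m = A at *
  generalize poch (t - j + 2) m = B at *
  generalize ((m + 1).choose (j + 1) : ℝ) ^ 2 * ((2 * m + 2 + j).choose (m + 1) : ℝ) = c' at *
  generalize ((m + 1).choose j : ℝ) ^ 2 * ((2 * m + 1 + j).choose (m + 1) : ℝ) = c at *
  have hf : ((m + 1).factorial : ℝ) ≠ 0 := by positivity
  generalize ((m + 1).factorial : ℝ) = f at *
  rw [show (-((m : ℝ) + 1) * ((j + 1) ^ 2 * (m + (j + 1)) * c' * A))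
    = -((m : ℝ) + 1) * (((j : ℝ) + 1) ^ 2 * (m + 1 + j) * c') * A by ring, hc]
  unfold recP1
  field_simp
  linear_combination (-c) * (t ^ 3 + 2 * (m + 1) * t ^ 2 - (m + 1) * (j + 2 * (m + 1)) * t
    - (m + 1) * (j + 2 * (m + 1)) * (j - (m + 1))) * e4

theorem rightT_up (m : ℕ) (t : ℝ) :
    4 * ((m : ℝ) + 2) ^ 3 * (m + 1) ^ 2 * (2 * m + 3) ^ 2 * rightT (m + 1) t
      = upX (m + 1) t * rightT m t + t ^ 2 * upY (m + 1) t * rightT m (t + 1) := by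
  set e : ℕ → ℝ := fun j => ((m + 2).choose j : ℝ) ^ 2 * ((2 * m + 1 + j).choose (m + 1) : ℝ)
    / (m + 1 + j) with he
  have hpos : ∀ j : ℕ, (0 : ℝ) < m + 1 + j := fun j => by positivity
  have hlow : ∀ s : ℝ, ((m : ℝ) + 2) ^ 2 * (m + 1).factorial * rightT m s
      = ∑ j ∈ Finset.range (m + 3), ((m : ℝ) + 2 - j) ^ 2 * (m + 1 + j) * e j
        * poch (s - j) (m + 1) := by
    intro s
    rw [Finset.sum_range_succ]
    simp only [rightT, Finset.mul_sum]
    have hz : ((m : ℝ) + 2 - (m + 2 : ℕ)) = 0 := by push_cast; ring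
    rw [hz]
    simp only [ne_eq, OfNat.ofNat_ne_zero, not_false_eq_true, zero_pow, zero_mul, add_zero]
    refine Finset.sum_congr rfl fun j hj => ?_
    have hf : ((m + 1).factorial : ℝ) ≠ 0 := by positivity
    have hc : ((m + 1).choose j : ℝ) * (m + 2) = (m + 2).choose j * (m + 2 - j) := by
      have hj' : j ≤ m + 1 := by simpa [Nat.lt_succ_iff] using hj
      have := Nat.choose_mul_succ_eq (m + 1) j
      have h2 : (((m + 1).choose j * (m + 1 + 1) : ℕ) : ℝ)
        = (((m + 1 + 1).choose j * (m + 1 + 1 - j) : ℕ) : ℝ) := by rw [this]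
      rw [Nat.cast_mul, Nat.cast_mul, Nat.cast_sub (by omega)] at h2
      push_cast at h2
      rw [show (m : ℝ) + 1 + 1 = m + 2 by ring] at h2
      exact h2
    simp only [he]
    have := (hpos j).ne'
    field_simp
    linear_combination poch (s - j) (m + 1) * ((2 * m + 1 + j).choose (m + 1) : ℝ) *
      (((m + 1).choose j : ℝ) * (m + 2) + (m + 2).choose j * (m + 2 - j)) * hc
  have hhigh : ((m : ℝ) + 2) ^ 2 * (m + 1).factorial * rightT (m + 1) t
      = ∑ j ∈ Finset.range (m + 3), (2 * ((m : ℝ) + 1) + 1 + j) * (2 * (m + 1) + j) * e j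
        * poch (t - j) (m + 2) := by
    simp only [rightT, Finset.mul_sum]
    refine Finset.sum_congr rfl fun j _ => ?_
    have h1 := choose_mul_succ_cast (m + j) (m + 1)
    have h2 := Nat.add_one_mul_choose_eq (2 * m + 2 + j) (m + 1)
    have h2' : ((2 * m + 2 + j + 1 : ℕ) : ℝ) * ((2 * m + 2 + j).choose (m + 1) : ℝ)
      = ((2 * m + 2 + j + 1).choose (m + 1 + 1) : ℝ) * ((m + 1 + 1 : ℕ) : ℝ) := by
        exact_mod_cast h2
    rw [show m + j + (m + 1) = 2 * m + 1 + j by ring,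
      show 2 * m + 1 + j + 1 = 2 * m + 2 + j by ring] at h1
    rw [show 2 * (m + 1) + 1 + j = 2 * m + 2 + j + 1 by ring,
      show m + 1 + 1 = m + 2 by ring, Nat.factorial_succ (m + 1)] at *
    simp only [he]
    have := (hpos j).ne'
    have hf : ((m + 1).factorial : ℝ) ≠ 0 := by positivity
    push_cast at *
    generalize ((2 * m + 2 + j).choose (m + 1) : ℝ) = a at *
    generalize ((2 * m + 2 + j + 1).choose (m + 2) : ℝ) = b at *
    generalize ((2 * m + 1 + j).choose (m + 1) : ℝ) = c at *
    generalize ((m + 2).choose j : ℝ) = d at *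
    have h3 : (m : ℝ) + 1 + 1 ≠ 0 := by positivity
    field_simp
    linear_combination (-d ^ 2 * (m + 2) * (m + 1 + j)) * poch (t - j) (m + 2) * h2'
      - d ^ 2 * (m + 2) * (2 * m + 2 + j + 1) * poch (t - j) (m + 2) * h1
  have hsucc : ∀ j : ℕ, ((j : ℝ) + 1) ^ 2 * (m + 1 + (j + 1)) * e (j + 1)
      = ((m : ℝ) + 2 - j) ^ 2 * (2 * (m + 1) + j) * e j := by
    intro j
    have h1 := choose_succ_mul_cast (m + 2) j
    have h2 := choose_mul_succ_cast (m + j) (m + 1)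
    rw [show m + j + (m + 1) = 2 * m + 1 + j by ring,
      show 2 * m + 1 + j + 1 = 2 * m + 1 + (j + 1) by ring] at h2
    simp only [he]
    have h3 := (hpos j).ne'
    have h4 := (hpos (j + 1)).ne'
    push_cast at *
    generalize ((2 * m + 1 + (j + 1)).choose (m + 1) : ℝ) = a at *
    generalize ((2 * m + 1 + j).choose (m + 1) : ℝ) = c at *
    generalize ((m + 2).choose j : ℝ) = d at *
    generalize ((m + 2).choose (j + 1) : ℝ) = d' at *
    field_simp
    linear_combination (a * (m + 1 + j)) * (d' * (j + 1) + d * (m + 2 - j)) * h1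
      - d ^ 2 * (m + 2 - j) ^ 2 * h2
  set G : ℕ → ℝ := fun j => (j : ℝ) ^ 2 * (m + 1 + j) * e j * upCert (m + 1) t j
      * poch (t - j + 1) (m + 1) with hG
  have key : ∑ j ∈ Finset.range (m + 3), (G (j + 1) - G j) = 0 := by
    rw [Finset.sum_range_sub]
    simp [hG, he]
  have hmain : 4 * ((m : ℝ) + 2) ^ 3 * (m + 1) ^ 2 * (2 * m + 3) ^ 2 *
        (((m : ℝ) + 2) ^ 2 * (m + 1).factorial * rightT (m + 1) t)
      - upX (m + 1) t * (((m : ℝ) + 2) ^ 2 * (m + 1).factorial * rightT m t)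
      - t ^ 2 * upY (m + 1) t * (((m : ℝ) + 2) ^ 2 * (m + 1).factorial * rightT m (t + 1)) = 0 := by
    rw [hhigh, hlow, hlow, ← key]
    simp only [Finset.mul_sum, ← Finset.sum_sub_distrib]
    refine Finset.sum_congr rfl fun j _ => ?_
    simp only [hG]
    push_cast
    rw [hsucc, show t - ((j : ℝ) + 1) + 1 = t - j by ring, show t + 1 - (j : ℝ) = t - j + 1 by ring]
    have e1 : poch (t - j) (m + 1) = (t - j) * poch (t - j + 1) m := poch_succ_left _ _
    have e2 : poch (t - j + 1) (m + 1) = poch (t - j + 1) m * (t - j + 1 + m) :=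
      poch_succ_right _ _
    have e3 : poch (t - j) (m + 2) = (t - j) * (poch (t - j + 1) m * (t - j + 1 + m)) := by
      rw [poch_succ_left, e2]
    rw [e1, e2, e3]
    have := up_cert_identity (m + 1) t j
    linear_combination (e j * poch (t - j + 1) m) * this
  have hne : ((m : ℝ) + 2) ^ 2 * (m + 1).factorial ≠ 0 := by positivity
  apply mul_left_cancel₀ hne
  linear_combination hmain

open Polynomial in
/-- `f` agrees on the positive half-line with a rational function without positive poles, of degree
at most `e`. -/
def RatDeg (e : ℤ) (f : ℝ → ℝ) : Prop :=
  ∃ P Q : ℝ[X], (P.natDegree : ℤ) ≤ Q.natDegree + e ∧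
    ∀ t, 0 < t → Q.eval t ≠ 0 ∧ f t = P.eval t / Q.eval t

namespace RatDeg

open Polynomial Filter Topology Asymptotics

variable {e e₁ e₂ : ℤ} {f g : ℝ → ℝ}

theorem congr (hf : RatDeg e f) (h : ∀ t, 0 < t → g t = f t) : RatDeg e g := by
  obtain ⟨P, Q, hd, hq⟩ := hf
  exact ⟨P, Q, hd, fun t ht => ⟨(hq t ht).1, by rw [h t ht, (hq t ht).2]⟩⟩

theorem mono (hf : RatDeg e₁ f) (h : e₁ ≤ e₂) : RatDeg e₂ f := by
  obtain ⟨P, Q, hd, hq⟩ := hf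
  exact ⟨P, Q, by lia, hq⟩

theorem ne_zero_of_eval {Q : ℝ[X]} (h : ∀ t, 0 < t → Q.eval t ≠ 0) : Q ≠ 0 := by
  rintro rfl
  exact h 1 one_pos (by simp)

theorem const (c : ℝ) : RatDeg 0 fun _ => c :=
  ⟨C c, 1, by simp, fun t _ => by simp⟩

theorem add_const (c : ℝ) : RatDeg 1 fun t => t + c :=
  ⟨X + C c, 1, by simp, fun t _ => by simp⟩

theorem id : RatDeg 1 fun t => t :=
  ⟨X, 1, by simp, fun t _ => by simp⟩

theorem inv_add_const {c : ℝ} (hc : 0 ≤ c) : RatDeg (-1) fun t => (t + c)⁻¹ :=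
  ⟨1, X + C c, by simp, fun t ht => ⟨by simp; positivity, by simp⟩⟩

theorem mul (hf : RatDeg e₁ f) (hg : RatDeg e₂ g) : RatDeg (e₁ + e₂) fun t => f t * g t := by
  obtain ⟨P, Q, hd, hq⟩ := hf
  obtain ⟨P', Q', hd', hq'⟩ := hg
  refine ⟨P * P', Q * Q', ?_, fun t ht => ⟨?_, ?_⟩⟩
  · rw [natDegree_mul (ne_zero_of_eval fun t ht => (hq t ht).1)
      (ne_zero_of_eval fun t ht => (hq' t ht).1)]
    have := natDegree_mul_le (p := P) (q := P')
    push_cast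
    lia
  · rw [eval_mul]
    exact mul_ne_zero (hq t ht).1 (hq' t ht).1
  · beta_reduce
    rw [(hq t ht).2, (hq' t ht).2, eval_mul, eval_mul, div_mul_div_comm]

theorem add (hf : RatDeg e f) (hg : RatDeg e g) : RatDeg e fun t => f t + g t := by
  obtain ⟨P, Q, hd, hq⟩ := hf
  obtain ⟨P', Q', hd', hq'⟩ := hg
  refine ⟨P * Q' + Q * P', Q * Q', ?_, fun t ht => ⟨?_, ?_⟩⟩
  · rw [natDegree_mul (ne_zero_of_eval fun t ht => (hq t ht).1)
      (ne_zero_of_eval fun t ht => (hq' t ht).1)]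
    have h1 := natDegree_mul_le (p := P) (q := Q')
    have h2 := natDegree_mul_le (p := Q) (q := P')
    have h3 := natDegree_add_le (P * Q') (Q * P')
    push_cast
    rcases le_max_iff.1 h3 with h | h <;> lia
  · rw [eval_mul]
    exact mul_ne_zero (hq t ht).1 (hq' t ht).1
  · beta_reduce
    rw [(hq t ht).2, (hq' t ht).2, eval_mul, eval_add, eval_mul, eval_mul,
      div_add_div _ _ (hq t ht).1 (hq' t ht).1]

theorem const_mul (c : ℝ) (hf : RatDeg e f) : RatDeg e fun t => c * f t := by
  simpa using (const c).mul hf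

theorem sub (hf : RatDeg e f) (hg : RatDeg e g) : RatDeg e fun t => f t - g t :=
  (hf.add (hg.const_mul (-1))).congr fun t _ => by ring

theorem pow (hf : RatDeg e f) (k : ℕ) : RatDeg (k * e) fun t => f t ^ k := by
  induction k with
  | zero => simpa using const 1
  | succ k ih =>
    refine ((ih.mul hf).mono (by push_cast; lia)).congr fun t _ => pow_succ _ _

theorem sum {ι : Type*} (s : Finset ι) {f : ι → ℝ → ℝ} (hf : ∀ i, RatDeg e (f i)) (he : 0 ≤ e) :
    RatDeg e fun t => ∑ i ∈ s, f i t := by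
  classical
  induction s using Finset.induction_on with
  | empty => simpa using (const 0).mono he
  | insert a s ha ih => simpa only [Finset.sum_insert ha] using (hf a).add ih

theorem comp_add_one (hf : RatDeg e f) : RatDeg e fun t => f (t + 1) := by
  obtain ⟨P, Q, hd, hq⟩ := hf
  refine ⟨P.comp (X + C 1), Q.comp (X + C 1), ?_, fun t ht => ?_⟩
  · simpa only [natDegree_comp, natDegree_X_add_C, mul_one] using hd
  · simpa using hq (t + 1) (by positivity)

theorem poch_add (c : ℝ) (k : ℕ) : RatDeg k fun t => poch (t + c) k := by
  induction k with
  | zero => simpa [poch] using const 1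
  | succ k ih =>
    refine ((ih.mul (add_const (c + k))).mono (by simp)).congr fun t _ => ?_
    rw [poch_succ_right, add_assoc]

theorem inv_poch_add {c : ℝ} (hc : 0 ≤ c) (k : ℕ) : RatDeg (-k) fun t => (poch (t + c) k)⁻¹ := by
  induction k with
  | zero => simpa [poch] using const 1
  | succ k ih =>
    refine ((ih.mul (inv_add_const (c := c + k) (by positivity))).mono
      (by push_cast; lia)).congr fun t _ => ?_
    rw [poch_succ_right, add_assoc, mul_inv]

theorem hasDerivAt_aux {P Q : ℝ[X]} (hq : ∀ t, 0 < t → Q.eval t ≠ 0 ∧ f t = P.eval t / Q.eval t)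
    {t : ℝ} (ht : 0 < t) :
    HasDerivAt f ((P.derivative.eval t * Q.eval t - P.eval t * Q.derivative.eval t)
      / Q.eval t ^ 2) t := by
  refine ((P.hasDerivAt t).div (Q.hasDerivAt t) (hq t ht).1).congr_of_eventuallyEq ?_
  filter_upwards [lt_mem_nhds ht] with s hs
  exact (hq s hs).2

theorem differentiableAt (hf : RatDeg e f) {t : ℝ} (ht : 0 < t) : DifferentiableAt ℝ f t := by
  obtain ⟨P, Q, -, hq⟩ := hf
  exact (hasDerivAt_aux hq ht).differentiableAt

theorem deriv (hf : RatDeg e f) : RatDeg (e - 1) (deriv f) := by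
  obtain ⟨P, Q, hd, hq⟩ := hf
  have hQ := ne_zero_of_eval fun t ht => (hq t ht).1
  have hq' : ∀ t, 0 < t → (Q * X).eval t ≠ 0 ∧ f t = (P * X).eval t / (Q * X).eval t := by
    intro t ht
    have := (hq t ht).1
    refine ⟨by simpa using ⟨this, ht.ne'⟩, ?_⟩
    rw [(hq t ht).2, eval_mul, eval_mul, eval_X, mul_div_mul_right _ _ ht.ne']
  have hQd : (Q * X).natDegree = Q.natDegree + 1 := natDegree_mul_X hQ
  have hd' : ((P * X).natDegree : ℤ) ≤ (Q * X).natDegree + e := by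
    have := natDegree_mul_le (p := P) (q := (X : ℝ[X]))
    rw [natDegree_X] at this
    lia
  have hQX : Q * X ≠ 0 := mul_ne_zero hQ X_ne_zero
  generalize P * X = P at *
  generalize Q * X = S at *
  refine ⟨Polynomial.derivative P * S - P * Polynomial.derivative S, S ^ 2, ?_, fun t ht => ⟨?_,
      ?_⟩⟩
  · rw [natDegree_pow]
    have h1 : (Polynomial.derivative P * S).natDegree + 1 ≤ P.natDegree + S.natDegree := by
      rcases Nat.eq_zero_or_pos P.natDegree with h | h
      · rw [natDegree_eq_zero.1 h |>.choose_spec.symm]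
        simp
        lia
      · have := natDegree_mul_le (p := Polynomial.derivative P) (q := S)
        have := natDegree_derivative_le P
        lia
    have h2 : (P * Polynomial.derivative S).natDegree + 1 ≤ P.natDegree + S.natDegree := by
      have := natDegree_mul_le (p := P) (q := Polynomial.derivative S)
      have := natDegree_derivative_le S
      lia
    have h3 := natDegree_sub_le (Polynomial.derivative P * S) (P * Polynomial.derivative S)
    push_cast
    rcases le_max_iff.1 h3 with h | h <;> lia
  · simpa using pow_ne_zero 2 (hq' t ht).1
  · rw [(hasDerivAt_aux hq' ht).deriv]
    simp

theorem tendsto_zero (hf : RatDeg e f) (he : e < 0) : Tendsto f atTop (𝓝 0) := by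
  obtain ⟨P, Q, hd, hq⟩ := hf
  have hQ := ne_zero_of_eval fun t ht => (hq t ht).1
  have : P.degree < Q.degree := by
    refine degree_lt_degree ?_
    lia
  refine (Polynomial.div_tendsto_atTop_zero_of_degree_lt P Q this).congr' ?_
  filter_upwards [eventually_gt_atTop 0] with t ht using (hq t ht).2.symm

theorem summable (hf : RatDeg e f) (he : e ≤ -2) (a : ℝ) :
    Summable fun ν : ℕ => f (a + ν) := by
  obtain ⟨P, Q, hd, hq⟩ := hf
  have hQ := ne_zero_of_eval fun t ht => (hq t ht).1
  have hdeg : (P * X ^ 2).degree ≤ Q.degree := by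
    rw [degree_eq_natDegree hQ]
    refine degree_le_of_natDegree_le ?_
    have := natDegree_mul_le (p := P) (q := (X : ℝ[X]) ^ 2)
    rw [natDegree_X_pow] at this
    lia
  have hO := (Polynomial.isBigO_atTop_of_degree_le _ _ hdeg)
  have hO2 : f =O[atTop] fun t => (t ^ 2)⁻¹ := by
    obtain ⟨C, hC⟩ := hO.bound
    refine IsBigO.of_bound C ?_
    filter_upwards [hC, eventually_gt_atTop 0] with t h ht
    rw [(hq t ht).2, norm_div, norm_inv, ← div_eq_mul_inv, div_le_div_iff₀
      (norm_pos_iff.2 (hq t ht).1) (norm_pos_iff.2 (by positivity))]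
    simpa using h
  have hT : Tendsto (fun ν : ℕ => a + (ν : ℝ)) atTop atTop :=
    tendsto_atTop_add_const_left _ _ tendsto_natCast_atTop_atTop
  have hO3 := hO2.comp_tendsto hT
  refine summable_of_isBigO_nat (Real.summable_nat_pow_inv.2 (one_lt_two : 1 < 2))
    (hO3.trans ?_)
  have hlin : (fun ν : ℕ => (ν : ℝ)) =O[atTop] fun ν : ℕ => a + (ν : ℝ) := by
    refine IsBigO.of_bound 2 ?_
    filter_upwards [hT.eventually_ge_atTop 0,
      tendsto_natCast_atTop_atTop.eventually_ge_atTop (-2 * a)] with ν h1 h2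
    rw [Real.norm_of_nonneg h1, Real.norm_of_nonneg (Nat.cast_nonneg _)]
    linarith
  refine (hlin.pow 2).inv_rev ?_
  filter_upwards [eventually_gt_atTop 0] with ν hν h
  have : (0 : ℝ) < ν := by exact_mod_cast hν
  exact absurd h (by positivity)

theorem hasSum_deriv_of_telescope {F E : ℝ → ℝ} (hF : RatDeg 0 F) (hE : RatDeg (-1) E)
    (h : ∀ t, 0 < t → E t = F (t + 1) - F t) {a : ℝ} (ha : 0 < a) :
    HasSum (fun ν : ℕ => _root_.deriv E (a + ν)) (-_root_.deriv F a) := by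
  have hd : ∀ t, 0 < t → _root_.deriv E t = _root_.deriv F (t + 1) - _root_.deriv F t := by
    intro t ht
    have h1 : E =ᶠ[𝓝 t] fun s => F (s + 1) - F s := by
      filter_upwards [lt_mem_nhds ht] with s hs using h s hs
    rw [h1.deriv_eq, deriv_fun_sub (hF.comp_add_one.differentiableAt ht) (hF.differentiableAt ht),
      deriv_comp_add_const]
  have hs := (hE.deriv.summable (by norm_num) a)
  have hlim : Tendsto (fun N : ℕ => ∑ ν ∈ Finset.range N, _root_.deriv E (a + ν)) atTop
      (𝓝 (0 - _root_.deriv F a)) := by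
    have h2 : ∀ N : ℕ, ∑ ν ∈ Finset.range N, _root_.deriv E (a + ν)
        = _root_.deriv F (a + N) - _root_.deriv F a := by
      intro N
      have := Finset.sum_range_sub (fun ν : ℕ => _root_.deriv F (a + ν)) N
      simp only [Nat.cast_zero, add_zero] at this
      rw [← this]
      refine Finset.sum_congr rfl fun ν _ => ?_
      rw [hd _ (by positivity)]
      push_cast
      ring_nf
    simp only [h2]
    exact ((hF.deriv.tendsto_zero (by norm_num)).comp (tendsto_atTop_add_const_left _ _
      tendsto_natCast_atTop_atTop)).sub_const _
  rw [zero_sub] at hlim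
  exact tendsto_nhds_unique hs.hasSum.tendsto_sum_nat hlim ▸ hs.hasSum

end RatDeg

theorem poch_one (k : ℕ) : poch 1 k = k.factorial := by
  induction k with
  | zero => simp [poch]
  | succ k ih => rw [poch_succ_right, ih, Nat.factorial_succ]; push_cast; ring

theorem poch_natCast_add_one (a k : ℕ) :
    poch ((a : ℝ) + 1) k = (a + k).factorial / a.factorial := by
  have h := poch_add 1 a k
  rw [poch_one, poch_one, add_comm 1 (a : ℝ)] at h
  rw [h]
  field_simp

theorem poch_neg_natCast (k : ℕ) : poch (-(k : ℝ)) k = (-1) ^ k * k.factorial := by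
  induction k with
  | zero => simp [poch]
  | succ k ih =>
    rw [poch_succ_left, show -((k + 1 : ℕ) : ℝ) + 1 = -k by push_cast; ring, ih,
      Nat.factorial_succ]
    push_cast
    ring

theorem hasDerivAt_sub_mul {g : ℝ → ℝ} {c : ℝ} (hg : DifferentiableAt ℝ g c) :
    HasDerivAt (fun t => (t - c) * g t) (g c) c := by
  simpa using ((hasDerivAt_id c).sub_const c).fun_mul hg.hasDerivAt

/-- The constant factor of `R (m + 1) 1`. -/
noncomputable def leftC (m : ℕ) : ℝ := -((m + 1).factorial : ℝ) ^ 2 / (2 * m + 1).factorial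

theorem R_succ_one (m : ℕ) {t : ℝ} (ht : 0 < t) :
    R (m + 1) 1 t = leftC m * ((t + (m + 1) / 2) * (t - (m + 1)) * (t + 2 * (m + 1)))
      * poch (t - (2 * m + 1)) (2 * m + 1) * poch (t + (m + 2)) (2 * m + 1)
      / poch t (m + 2) ^ 4 := by
  have h1 : poch t (2 * m + 2) = poch t (m + 2) * poch (t + (m + 2)) m := by
    rw [show 2 * m + 2 = (m + 2) + m by ring, poch_add]
    push_cast
    ring_nf
  have h2 : poch (t + (m + 2)) (m + 1) = poch (t + (m + 2)) m * (t + 2 * (m + 1)) := by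
    rw [poch_succ_right]
    ring
  have h3 : poch t (m + 2) ≠ 0 := (poch_pos ht _).ne'
  have h4 : poch (t + (m + 2)) m ≠ 0 := (poch_pos (by positivity) _).ne'
  unfold R leftC
  rw [show 2 * (m + 1) - 1 = 2 * m + 1 by omega]
  push_cast
  rw [show t - 2 * ((m : ℝ) + 1) + 1 = t - (2 * m + 1) by ring,
    show t + ((m : ℝ) + 1) + 1 = t + (m + 2) by ring, show m + 1 + 1 = m + 2 by ring, h1, h2,
    show poch (t - (m + 1)) 1 = t - (m + 1) by simp [poch]]
  field_simp
  simp

theorem ratDeg_R (m : ℕ) : RatDeg (-3) (R (m + 1) 1) := by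
  have h : RatDeg (0 + (1 + 1 + 1) + (2 * m + 1 : ℕ) + (2 * m + 1 : ℕ) + (4 : ℕ) * (-(m + 2 : ℕ)))
      fun t => leftC m * ((t + (m + 1) / 2) * (t + (-(m + 1))) * (t + 2 * (m + 1)))
        * poch (t + (-(2 * m + 1))) (2 * m + 1) * poch (t + (m + 2)) (2 * m + 1)
        * (poch (t + 0) (m + 2))⁻¹ ^ 4 :=
    ((((RatDeg.const _).mul (((RatDeg.add_const _).mul (RatDeg.add_const _)).mul
      (RatDeg.add_const _))).mul (RatDeg.poch_add _ _)).mul (RatDeg.poch_add _ _)).mul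
      ((RatDeg.inv_poch_add le_rfl _).pow 4)
  refine (h.mono (by push_cast; lia)).congr fun t ht => ?_
  rw [R_succ_one m ht]
  simp only [add_zero, sub_eq_add_neg, div_eq_mul_inv, inv_pow]

/-- The rational function whose forward difference is the inhomogeneous recurrence for `R`. -/
noncomputable def leftV (m : ℕ) (t : ℝ) : ℝ :=
  leftC m / (4 * (m + 2) ^ 3 * (m + 1) ^ 4 * (2 * m + 3)) * leftS (m + 1) t
    * poch (t - (2 * m + 2)) (2 * m + 2) * poch (t + (m + 2)) (2 * m + 1) / poch t (m + 2) ^ 4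

theorem ratDeg_leftV (m : ℕ) : RatDeg 0 (leftV m) := by
  have hS : RatDeg 5 (leftS (m + 1)) := by
    unfold leftS
    have h (c : ℝ) (k : ℕ) (hk : k ≤ 5) : RatDeg 5 fun t => c * t ^ k :=
      ((RatDeg.id.pow k).const_mul c).mono (by lia)
    refine RatDeg.add (RatDeg.add (RatDeg.add (RatDeg.add (RatDeg.add ?_ ?_) (h _ 2 (by simp)))
      (h _ 3 (by simp))) (h _ 4 (by simp))) (h _ 5 (by simp))
    · exact (RatDeg.const _).mono (by simp)
    · exact (RatDeg.id.const_mul _).mono (by simp)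
  have h : RatDeg (0 + 5 + (2 * m + 2 : ℕ) + (2 * m + 1 : ℕ) + (4 : ℕ) * (-(m + 2 : ℕ)))
      fun t => leftC m / (4 * (m + 2) ^ 3 * (m + 1) ^ 4 * (2 * m + 3)) * leftS (m + 1) t
        * poch (t + (-(2 * m + 2))) (2 * m + 2) * poch (t + (m + 2)) (2 * m + 1)
        * (poch (t + 0) (m + 2))⁻¹ ^ 4 :=
    ((((RatDeg.const _).mul hS).mul (RatDeg.poch_add _ _)).mul (RatDeg.poch_add _ _)).mul
      ((RatDeg.inv_poch_add le_rfl _).pow 4)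
  refine (h.mono (by push_cast; lia)).congr fun t ht => ?_
  unfold leftV
  simp only [add_zero, sub_eq_add_neg, div_eq_mul_inv, inv_pow]

/-- The coefficient of the first order recurrence satisfied by both sides. -/
noncomputable def recCoeff (n : ℝ) : ℝ := 16 * (2 * n + 1) ^ 4 / (n * (n + 1) ^ 3)

theorem leftV_telescope (m : ℕ) {t : ℝ} (ht : 0 < t) :
    R (m + 2) 1 t + recCoeff (m + 1) * R (m + 1) 1 t = leftV m (t + 1) - leftV m t := by
  rw [R_succ_one m ht, R_succ_one (m + 1) ht]
  unfold leftV recCoeff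
  push_cast
  have hC : leftC (m + 1) = leftC m * (m + 2) ^ 2 / ((2 * m + 3) * (2 * m + 2)) := by
    unfold leftC
    rw [show 2 * (m + 1) + 1 = 2 * m + 1 + 1 + 1 by ring, Nat.factorial_succ (2 * m + 1 + 1),
      Nat.factorial_succ (2 * m + 1), Nat.factorial_succ (m + 1)]
    push_cast
    have : ((2 * m + 1).factorial : ℝ) ≠ 0 := by positivity
    field_simp
    ring
  set A := poch (t - (2 * m + 1)) (2 * m + 1) with hA
  set B := poch (t + (m + 2)) (2 * m + 1) with hB
  set p := poch t (m + 2) with hp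
  have hp0 : p ≠ 0 := (poch_pos ht _).ne'
  have hA1 : poch (t - (2 * (m + 1) + 1)) (2 * (m + 1) + 1)
      = (t - (2 * m + 3)) * (t - (2 * m + 2)) * A := by
    rw [show 2 * (m + 1) + 1 = 2 * m + 1 + 1 + 1 by ring, poch_succ_left, poch_succ_left, hA]
    ring_nf
  have hA2 : poch (t - (2 * m + 2)) (2 * m + 2) = (t - (2 * m + 2)) * A := by
    rw [poch_succ_left, hA]
    ring_nf
  have hA3 : poch (t + 1 - (2 * m + 2)) (2 * m + 2) = A * t := by
    rw [poch_succ_right, hA]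
    push_cast
    ring_nf
  have hB1 : poch (t + (m + 1 + 2)) (2 * (m + 1) + 1) = B * (t + (3 * m + 3)) * (t + (3 * m + 4))
      * (t + (3 * m + 5)) / (t + (m + 2)) := by
    have h := poch_succ_left (t + (m + 2)) (2 * (m + 1) + 1)
    rw [show 2 * (m + 1) + 1 + 1 = 2 * m + 1 + 1 + 1 + 1 by ring, poch_succ_right,
      poch_succ_right, poch_succ_right, ← hB] at h
    rw [eq_div_iff (by positivity), show t + ((m : ℝ) + 1 + 2) = t + (m + 2) + 1 by ring, mul_comm,
      ← h]
    push_cast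
    ring
  have hB2 : poch (t + 1 + (m + 2)) (2 * m + 1) = B * (t + (3 * m + 3)) / (t + (m + 2)) := by
    rw [eq_div_iff (by positivity), show t + 1 + ((m : ℝ) + 2) = t + (m + 2) + 1 by ring, mul_comm,
      mul_poch_add_one, ← hB]
    push_cast
    ring
  have hp1 : poch t (m + 1 + 2) = p * (t + (m + 2)) := by
    rw [show m + 1 + 2 = m + 2 + 1 by ring, poch_succ_right, ← hp]
    push_cast
    ring
  have hp2 : poch (t + 1) (m + 2) = p * (t + (m + 2)) / t := by
    rw [eq_div_iff ht.ne', mul_comm, mul_poch_add_one, ← hp]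
    push_cast
    ring
  rw [hC, hA1, hA2, hA3, hB1, hB2, hp1, hp2]
  have h1 : t + ((m : ℝ) + 2) ≠ 0 := by positivity
  have key := left_cert_identity (m + 1) t
  have e1 : (m : ℝ) + 1 + 1 = m + 2 := by ring
  have e2 : 2 * ((m : ℝ) + 1) + 1 = 2 * m + 3 := by ring
  simp only [e1, e2] at key ⊢
  generalize leftS ((m : ℝ) + 1) (t + 1) = s1 at *
  generalize leftS ((m : ℝ) + 1) t = s0 at *
  generalize leftC m = c at *
  clear_value A B p
  clear hA hB hp hA1 hA2 hA3 hB1 hB2 hp1 hp2 hC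
  have lhs : c * (m + 2) ^ 2 / ((2 * m + 3) * (2 * m + 2)) *
        ((t + (m + 2) / 2) * (t - (m + 2)) * (t + 2 * (m + 2))) *
        ((t - (2 * m + 3)) * (t - (2 * m + 2)) * A) *
        (B * (t + (3 * m + 3)) * (t + (3 * m + 4)) * (t + (3 * m + 5)) / (t + (m + 2)))
        / (p * (t + (m + 2))) ^ 4
      + 16 * (2 * m + 3) ^ 4 / ((m + 1) * (m + 2) ^ 3) *
        (c * ((t + (m + 1) / 2) * (t - (m + 1)) * (t + 2 * (m + 1))) * A * B / p ^ 4)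
      = c * A * B / (p ^ 4 * (t + (m + 2)) ^ 5 * (4 * (m + 2) ^ 3 * (m + 1) ^ 4 * (2 * m + 3))) *
        (2 * (m + 2) ^ 5 * (m + 1) ^ 3 *
        ((t + (m + 2) / 2) * (t - (m + 1) - 1) * (t + 2 * (m + 1) + 2) * (t - 2 * (m + 1))
          * (t - 2 * (m + 1) - 1)
          * (t + 3 * (m + 1)) * (t + 3 * (m + 1) + 1) * (t + 3 * (m + 1) + 2))
      + 64 * (m + 1) ^ 3 * (2 * m + 3) ^ 5 *
        ((t + (m + 1) / 2) * (t - (m + 1)) * (t + 2 * (m + 1)) * (t + (m + 1) + 1) ^ 5)) := by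
    field_simp
    ring
  rw [lhs, key]
  field_simp
  ring

theorem deriv_leftV (m : ℕ) :
    deriv (leftV m) (m + 2) = rightNum (m + 1) * (-1) ^ (m + 1) * (m + 1).factorial ^ 8
      * (4 * m + 4).factorial
      / ((m + 2) ^ 3 * (m + 1) ^ 4 * (2 * m + 3) ^ 5 * (2 * m + 2).factorial ^ 6) := by
  set g : ℝ → ℝ := fun t => leftC m / (4 * (m + 2) ^ 3 * (m + 1) ^ 4 * (2 * m + 3))
    * leftS (m + 1) t * (poch (t - (2 * m + 2)) m * poch (t - (m + 1)) (m + 1))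
    * poch (t + (m + 2)) (2 * m + 1) / poch t (m + 2) ^ 4 with hg
  have hV : leftV m = fun t => (t - (m + 2)) * g t := by
    funext t
    have : poch (t - (2 * m + 2)) (2 * m + 2)
        = poch (t - (2 * m + 2)) m * (t - (m + 2)) * poch (t - (m + 1)) (m + 1) := by
      rw [show 2 * m + 2 = m + 1 + (m + 1) by ring, poch_add, poch_succ_right]
      push_cast
      ring_nf
    simp only [leftV, hg, this]
    ring
  have hp : poch ((m : ℝ) + 2) (m + 2) ≠ 0 := (poch_pos (by positivity) _).ne'
  have hd : DifferentiableAt ℝ g (m + 2) := by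
    have hpoch : ∀ k : ℕ, Differentiable ℝ fun t => poch t k := fun k => by
      unfold poch
      fun_prop
    have h1 : DifferentiableAt ℝ (fun t => poch (t - (2 * m + 2)) m) (m + 2) :=
      (hpoch _).comp (differentiable_id.sub_const _) _
    have h2 : DifferentiableAt ℝ (fun t : ℝ => poch (t - (m + 1)) (m + 1)) (m + 2) :=
      (hpoch _).comp (differentiable_id.sub_const _) _
    have h3 : DifferentiableAt ℝ (fun t : ℝ => poch (t + (m + 2)) (2 * m + 1)) (m + 2) :=
      (hpoch _).comp (differentiable_id.add_const _) _
    have h4 : DifferentiableAt ℝ (leftS (m + 1)) (m + 2) := by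
      unfold leftS
      fun_prop
    exact ((((h4.const_mul _).mul (h1.mul h2)).mul h3).div ((hpoch _ _).pow 4)
      (pow_ne_zero 4 hp))
  rw [hV, (hasDerivAt_sub_mul hd).deriv, hg]
  beta_reduce
  rw [show (m : ℝ) + 2 - (2 * m + 2) = -m by ring, poch_neg_natCast,
    show (m : ℝ) + 2 - (m + 1) = 1 by ring, poch_one,
    show (m : ℝ) + 2 + (m + 2) = (2 * m + 3 : ℕ) + 1 by push_cast; ring, poch_natCast_add_one,
    show (m : ℝ) + 2 = (m + 1 : ℕ) + 1 by push_cast; ring, poch_natCast_add_one]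
  have hS : leftS (m + 1) (m + 2) = 2 * (2 * m + 3) * rightNum (m + 1) := by
    unfold leftS rightNum
    ring
  push_cast
  rw [show (m : ℝ) + 1 + 1 = m + 2 by ring, hS, leftC, show 2 * m + 3 + (2 * m + 1) = 4 * m
      + 4 by ring,
    show m + 1 + (m + 2) = 2 * m + 3 by ring, Nat.factorial_succ (2 * m + 2),
    Nat.factorial_succ (2 * m + 1), Nat.factorial_succ m]
  have h1 : ((2 * m + 1).factorial : ℝ) ≠ 0 := by positivity
  have h2 : (m.factorial : ℝ) ≠ 0 := by positivity
  push_cast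
  generalize ((2 * m + 1).factorial : ℝ) = a at *
  generalize (m.factorial : ℝ) = b at *
  generalize ((4 * m + 4).factorial : ℝ) = c at *
  generalize rightNum (m + 1) = d at *
  have h3 : 2 * (m : ℝ) + 2 + 1 ≠ 0 := by positivity
  have h4 : 2 * (m : ℝ) + 1 + 1 ≠ 0 := by positivity
  field_simp
  ring

theorem deriv_R_succ_one_self (m : ℕ) : deriv (R (m + 1) 1) (m + 1) = 0 := by
  set g : ℝ → ℝ := fun t => leftC m * ((t + (m + 1) / 2) * (t + 2 * (m + 1)))
      * (poch (t - (2 * m + 1)) m * poch (t - m) m * (t - (m + 1))) * poch (t + (m + 2)) (2 * m + 1)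
      / poch t (m + 2) ^ 4 with hg
  have hp : poch ((m : ℝ) + 1) (m + 2) ≠ 0 := (poch_pos (by positivity) _).ne'
  have hpoch : ∀ k : ℕ, Differentiable ℝ fun t => poch t k := fun k => by
    unfold poch
    fun_prop
  have hd : DifferentiableAt ℝ g (m + 1) := by
    have h1 : DifferentiableAt ℝ (fun t => poch (t - (2 * m + 1)) m) (m + 1) :=
      (hpoch _).comp (differentiable_id.sub_const _) _
    have h2 : DifferentiableAt ℝ (fun t : ℝ => poch (t - m) m) (m + 1) :=
      (hpoch _).comp (differentiable_id.sub_const _) _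
    have h3 : DifferentiableAt ℝ (fun t : ℝ => poch (t + (m + 2)) (2 * m + 1)) (m + 1) :=
      (hpoch _).comp (differentiable_id.add_const _) _
    have h4 : DifferentiableAt ℝ
      (fun t : ℝ => leftC m * ((t + (m + 1) / 2) * (t + 2 * (m + 1)))) (m + 1) := by
      fun_prop
    have h5 : DifferentiableAt ℝ (fun t : ℝ => t - (m + 1)) (m + 1) := by fun_prop
    exact ((h4.mul ((h1.mul h2).mul h5)).mul h3).div ((hpoch _ _).pow 4) (pow_ne_zero 4 hp)
  have hR : R (m + 1) 1 =ᶠ[nhds ((m : ℝ) + 1)] fun t => (t - (m + 1)) * g t := by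
    filter_upwards [lt_mem_nhds (show (0 : ℝ) < m + 1 by positivity)] with t ht
    have : poch (t - (2 * m + 1)) (2 * m + 1)
        = poch (t - (2 * m + 1)) m * (t - (m + 1)) * poch (t - m) m := by
      rw [show 2 * m + 1 = m + 1 + m by ring, poch_add, poch_succ_right]
      push_cast
      ring_nf
    rw [R_succ_one m ht, this, hg]
    ring
  rw [hR.deriv_eq, (hasDerivAt_sub_mul hd).deriv, hg]
  simp

theorem Zl_succ_one (m : ℕ) :
    Zl (m + 1) 1 = -(1 / 3) * ∑' ν : ℕ, deriv (R (m + 1) 1) (m + 2 + ν) := by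
  have hs := (ratDeg_R m).deriv.summable (by norm_num) (m + 1)
  rw [Zl, show ((m + 1 : ℕ) : ℝ) - (1 : ℕ) + 1 = m + 1 by push_cast; ring, hs.tsum_eq_zero_add]
  rw [Nat.cast_zero, add_zero, deriv_R_succ_one_self, zero_add]
  congr 1
  refine tsum_congr fun ν => ?_
  congr 1
  push_cast
  ring

theorem Zl_rec (m : ℕ) :
    Zl (m + 2) 1 + recCoeff (m + 1) * Zl (m + 1) 1 = 1 / 3 * deriv (leftV m) (m + 2) := by
  have h1 := ratDeg_R m
  have h2 := ratDeg_R (m + 1)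
  have hE : RatDeg (-3) fun t => R (m + 2) 1 t + recCoeff (m + 1) * R (m + 1) 1 t :=
    h2.add (h1.const_mul _)
  have ha : (0 : ℝ) < m + 2 := by positivity
  have key := ((ratDeg_leftV m).hasSum_deriv_of_telescope (hE.mono (by norm_num))
    (fun t ht => leftV_telescope m ht) ha).tsum_eq
  have hd : ∀ ν : ℕ, deriv (fun t => R (m + 2) 1 t + recCoeff (m + 1) * R (m + 1) 1 t)
      ((m : ℝ) + 2 + ν) = deriv (R (m + 2) 1) (m + 2 + ν)
        + recCoeff (m + 1) * deriv (R (m + 1) 1) (m + 2 + ν) := by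
    intro ν
    have hν : (0 : ℝ) < m + 2 + ν := by positivity
    rw [deriv_fun_add (h2.differentiableAt hν) ((h1.const_mul _).differentiableAt hν),
      deriv_const_mul_field]
  simp only [hd] at key
  rw [(h2.deriv.summable (by norm_num) _).tsum_add
    ((h1.deriv.summable (by norm_num) _).mul_left _), tsum_mul_left] at key
  rw [Zl_succ_one m, Zl, show ((m + 2 : ℕ) : ℝ) - (1 : ℕ) + 1 = m + 2 by push_cast; ring]
  linear_combination (-1 / 3) * key

/-- The product of Pochhammer symbols appearing in `Rtilde (m + 1) 1`, with the zero at `m + 1`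
removed. -/
noncomputable def rightK (m : ℕ) (t : ℝ) : ℝ :=
  (m + 1).factorial * poch (t - m) m / (poch t (m + 2) * poch (t + m) (m + 2))

/-- The product of Pochhammer symbols appearing in `Rtilde (m + 1) 1`, with the zero at `1`
removed. -/
noncomputable def rightG (m : ℕ) (t : ℝ) : ℝ :=
  (m + 1).factorial * poch (t - (m + 1)) m / (poch t (m + 2) * poch (t + m) (m + 2))

theorem sub_mul_rightK (m : ℕ) (t : ℝ) :
    (t - (m + 1)) * rightK m t = (t - 1) * rightG m t := by
  have h : (t - (m + 1)) * poch (t - m) m = poch (t - (m + 1)) m * (t - 1) := by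
    have := mul_poch_add_one (t - (m + 1)) m
    rw [show t - ((m : ℝ) + 1) + 1 = t - m by ring] at this
    rw [this]
    ring
  unfold rightK rightG
  linear_combination ((m + 1).factorial / (poch t (m + 2) * poch (t + m) (m + 2))) * h

theorem Rtilde_succ_one (m : ℕ) {t : ℝ} (ht : 0 < t) :
    Rtilde (m + 1) 1 t = (t - (m + 1)) * rightK m t * rightT m t := by
  have h1 : poch t (2 * m + 2) = poch t m * poch (t + m) (m + 2) := by
    rw [show 2 * m + 2 = m + (m + 2) by ring, poch_add]
  have h2 : poch (t - (m + 1)) (2 * m + 1) = (t - (m + 1)) * poch (t - m) m * poch t m := by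
    rw [show 2 * m + 1 = m + 1 + m by ring, poch_add, poch_succ_left]
    push_cast
    ring_nf
  have h3 : poch t m ≠ 0 := (poch_pos ht _).ne'
  have h4 : poch t (m + 2) ≠ 0 := (poch_pos ht _).ne'
  have h5 : poch (t + m) (m + 2) ≠ 0 := (poch_pos (by positivity) _).ne'
  unfold Rtilde rightK rightT
  rw [show 2 * (m + 1) - 1 = 2 * m + 1 by omega]
  push_cast
  rw [h1, h2]
  field_simp

theorem rightK_succ (m : ℕ) {t : ℝ} (ht : 0 < t) :
    rightK (m + 1) t = rightK m t * ((m + 2) * (t - (m + 1)) * (t + m))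
      / ((t + (m + 2)) * (t + (2 * m + 2)) * (t + (2 * m + 3))) := by
  have h1 : poch (t - (m + 1)) (m + 1) = (t - (m + 1)) * poch (t - m) m := by
    rw [poch_succ_left]
    ring_nf
  have h2 : poch t (m + 3) = poch t (m + 2) * (t + (m + 2)) := by
    rw [poch_succ_right]
    push_cast
    ring
  have h3 : (t + m) * poch (t + (m + 1)) (m + 3)
      = poch (t + m) (m + 2) * (t + (2 * m + 2)) * (t + (2 * m + 3)) := by
    rw [show t + ((m : ℝ) + 1) = t + m + 1 by ring, mul_poch_add_one, poch_succ_right]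
    push_cast
    ring
  have h4 : poch t (m + 2) ≠ 0 := (poch_pos ht _).ne'
  have h5 : poch (t + m) (m + 2) ≠ 0 := (poch_pos (by positivity) _).ne'
  have h6 : poch (t + (m + 1)) (m + 3) ≠ 0 := (poch_pos (by positivity) _).ne'
  unfold rightK
  rw [Nat.factorial_succ (m + 1)]
  push_cast
  rw [h1, h2]
  rw [div_mul_eq_mul_div, div_div, div_eq_div_iff (by positivity) (by positivity)]
  linear_combination (-((m : ℝ) + 2) * (m + 1).factorial * (t - (m + 1)) * poch (t - m) m
    * poch t (m + 2) * (t + (m + 2))) * h3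

theorem rightG_succ (m : ℕ) {t : ℝ} (ht : 0 < t) :
    rightG (m + 1) t = rightG m t * ((m + 2) * (t - (m + 2)) * (t + m))
      / ((t + (m + 2)) * (t + (2 * m + 2)) * (t + (2 * m + 3))) := by
  have h1 : poch (t - (m + 2)) (m + 1) = (t - (m + 2)) * poch (t - (m + 1)) m := by
    rw [poch_succ_left]
    ring_nf
  have h2 : poch t (m + 3) = poch t (m + 2) * (t + (m + 2)) := by
    rw [poch_succ_right]
    push_cast
    ring
  have h3 : (t + m) * poch (t + (m + 1)) (m + 3)
      = poch (t + m) (m + 2) * (t + (2 * m + 2)) * (t + (2 * m + 3)) := by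
    rw [show t + ((m : ℝ) + 1) = t + m + 1 by ring, mul_poch_add_one, poch_succ_right]
    push_cast
    ring
  have h4 : poch t (m + 2) ≠ 0 := (poch_pos ht _).ne'
  have h5 : poch (t + m) (m + 2) ≠ 0 := (poch_pos (by positivity) _).ne'
  have h6 : poch (t + (m + 1)) (m + 3) ≠ 0 := (poch_pos (by positivity) _).ne'
  unfold rightG
  rw [Nat.factorial_succ (m + 1)]
  push_cast
  rw [show (m : ℝ) + 1 + 1 = m + 2 by ring, h1, h2]
  rw [div_mul_eq_mul_div, div_div, div_eq_div_iff (by positivity) (by positivity)]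
  linear_combination (-((m : ℝ) + 2) * (m + 1).factorial * (t - (m + 2)) * poch (t - (m + 1)) m
    * poch t (m + 2) * (t + (m + 2))) * h3

theorem rightK_add_one (m : ℕ) {t : ℝ} (ht : 0 < t) :
    (t + 1 - (m + 1)) * rightK m (t + 1)
      = rightK m t * (t ^ 2 * (t + m)) / ((t + (m + 2)) * (t + (2 * m + 2))) := by
  have h1 : (t + 1 - (m + 1)) * poch (t + 1 - m) m = t * poch (t - m) m := by
    have := mul_poch_add_one (t - m) m
    rw [show t - (m : ℝ) + 1 = t + 1 - m by ring] at this
    linear_combination this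
  have h2 : t * poch (t + 1) (m + 2) = poch t (m + 2) * (t + (m + 2)) := by
    rw [mul_poch_add_one]
    push_cast
    ring
  have h3 : (t + m) * poch (t + 1 + m) (m + 2) = poch (t + m) (m + 2) * (t + (2 * m + 2)) := by
    rw [show t + 1 + (m : ℝ) = t + m + 1 by ring, mul_poch_add_one]
    push_cast
    ring
  have h4 : poch t (m + 2) ≠ 0 := (poch_pos ht _).ne'
  have h5 : poch (t + m) (m + 2) ≠ 0 := (poch_pos (by positivity) _).ne'
  have h6 : poch (t + 1) (m + 2) ≠ 0 := (poch_pos (by positivity) _).ne'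
  have h7 : poch (t + 1 + m) (m + 2) ≠ 0 := (poch_pos (by positivity) _).ne'
  have h2' : poch (t + 1) (m + 2) = poch t (m + 2) * (t + (m + 2)) / t := by
    rw [eq_div_iff ht.ne', ← h2, mul_comm]
  have h3' : poch (t + 1 + m) (m + 2) = poch (t + m) (m + 2) * (t + (2 * m + 2)) / (t + m) := by
    rw [eq_div_iff (by positivity), ← h3, mul_comm]
  unfold rightK
  rw [mul_div_assoc', mul_left_comm, h1, h2', h3']
  field_simp

/-- A function with simple zero at `1`, whose forward differences produce the recurrences of the
right-hand side, is `(t - 1) * rightF m A B t` for suitable polynomials `A` and `B`. -/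
noncomputable def rightF (m : ℕ) (A B : ℝ → ℝ) (t : ℝ) : ℝ :=
  rightG m t * (A t * rightT m t + t ^ 2 * B t * rightT m (t + 1)) / (t + (2 * m + 2))

theorem rightF_telescope (m : ℕ) (A B : ℝ → ℝ) {t : ℝ} (ht : 0 < t) :
    (t + 1 - 1) * rightF m A B (t + 1) - (t - 1) * rightF m A B t
      = rightK m t / ((t + (m + 2)) * (t + (2 * m + 2)) * (t + (2 * m + 3)) * (t + (m + 1))) *
        (rightT m t * (-t ^ 4 * (t + (m + 1) - 1) * B (t + 1) * (t + 3 * (m + 1))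
            - A t * (t - (m + 1)) * (t + (m + 1) + 1) * (t + 2 * (m + 1) + 1) * (t + (m + 1)))
          + t ^ 2 * rightT m (t + 1) * ((t + (m + 1) - 1) *
            (A (t + 1) * (t + (m + 1)) - B (t + 1) * recP1 (m + 1) t)
            - B t * (t - (m + 1)) * (t + (m + 1) + 1) * (t + 2 * (m + 1) + 1) * (t + (m
                + 1)))) := by
  have h1 : (t + 1 - 1) * rightF m A B (t + 1) = (t + 1 - (m + 1)) * rightK m (t + 1) *
      (A (t + 1) * rightT m (t + 1) + (t + 1) ^ 2 * B (t + 1) * rightT m (t + 1 + 1))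
        / (t + 1 + (2 * m + 2)) := by
    rw [sub_mul_rightK, rightF]
    ring
  have h2 : (t - 1) * rightF m A B t = (t - (m + 1)) * rightK m t *
      (A t * rightT m t + t ^ 2 * B t * rightT m (t + 1)) / (t + (2 * m + 2)) := by
    rw [sub_mul_rightK, rightF]
    ring
  have hT : (t + 1) ^ 2 * rightT m (t + 1 + 1) = -(recP1 (m + 1) t * rightT m (t + 1)
      + t ^ 2 * (t + 3 * (m + 1)) * rightT m t) / (t + (m + 1)) := by
    rw [eq_div_iff (by positivity), show t + 1 + 1 = t + 2 by ring]
    linear_combination rightT_rec m t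
  rw [h1, h2, rightK_add_one m ht, mul_right_comm ((t + 1) ^ 2), hT]
  generalize rightT m (t + 1) = T1
  generalize rightT m t = T0
  generalize rightK m t = K
  generalize recP1 (m + 1) t = P
  generalize A (t + 1) = A1
  generalize A t = A0
  generalize B (t + 1) = B1
  generalize B t = B0
  rw [show t + 1 + (2 * (m : ℝ) + 2) = t + (2 * m + 3) by ring]
  field_simp
  ring

/-- The auxiliary function making the recurrence for `Rtilde` telescope. -/
noncomputable def rightv (m : ℕ) (t : ℝ) : ℝ :=
  rightK m t * ((12 * (m + 1) - 5) * t + (m + 1) * (12 * (m + 1) - 7)) * rightT m t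

theorem Rtilde_telescope (m : ℕ) {t : ℝ} (ht : 0 < t) :
    8 * ((m : ℝ) + 1) ^ 4 * (m + 2) ^ 3 * (2 * m + 3) ^ 5 *
        (Rtilde (m + 2) 1 t + recCoeff (m + 1) * Rtilde (m + 1) 1 t)
      - (m + 1) ^ 3 * rightNum (m + 1) * rightv m t
    = (t + 1 - 1) * rightF m (certA1 (m + 1)) (certB1 (m + 1)) (t + 1)
      - (t - 1) * rightF m (certA1 (m + 1)) (certB1 (m + 1)) t := by
  rw [rightF_telescope m _ _ ht, ← right_cert_identity_one_zero, ← right_cert_identity_one_one,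
    Rtilde_succ_one m ht, Rtilde_succ_one (m + 1) ht, rightK_succ m ht]
  have hT : rightT (m + 1) t = (upX (m + 1) t * rightT m t
      + t ^ 2 * upY (m + 1) t * rightT m (t + 1))
        / (4 * ((m : ℝ) + 2) ^ 3 * (m + 1) ^ 2 * (2 * m + 3) ^ 2) := by
    rw [eq_div_iff (by positivity), mul_comm]
    exact rightT_up m t
  unfold rightv recCoeff
  push_cast
  rw [hT, show 2 * ((m : ℝ) + 1) + 1 = 2 * m + 3 by ring, show (m : ℝ) + 1 + 1 = m + 2 by ring]
  generalize upX (m + 1) t = X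
  generalize upY (m + 1) t = Y
  generalize rightT m (t + 1) = T1
  generalize rightT m t = T0
  generalize rightK m t = K
  generalize rightNum (m + 1) = D
  have h1 : (t : ℝ) + (2 * m + 2) ≠ 0 := by positivity
  have h2 : (t : ℝ) + (2 * m + 3) ≠ 0 := by positivity
  field_simp
  ring

theorem rightv_telescope (m : ℕ) {t : ℝ} (ht : 0 < t) :
    8 * ((m : ℝ) + 1) ^ 2 * (m + 2) ^ 3 * (2 * m + 3) ^ 5 * rightv (m + 1) t
      + (m + 1) ^ 5 * (m + 2) ^ 3 * (4 * m + 5) * (4 * m + 7) * rightv m t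
    = (t + 1 - 1) * rightF m (certA2 (m + 1)) (certB2 (m + 1)) (t + 1)
      - (t - 1) * rightF m (certA2 (m + 1)) (certB2 (m + 1)) t := by
  rw [rightF_telescope m _ _ ht, ← right_cert_identity_two_zero, ← right_cert_identity_two_one]
  unfold rightv
  rw [rightK_succ m ht]
  have hT : rightT (m + 1) t = (upX (m + 1) t * rightT m t
      + t ^ 2 * upY (m + 1) t * rightT m (t + 1))
        / (4 * ((m : ℝ) + 2) ^ 3 * (m + 1) ^ 2 * (2 * m + 3) ^ 2) := by
    rw [eq_div_iff (by positivity), mul_comm]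
    exact rightT_up m t
  push_cast
  rw [hT, show 2 * ((m : ℝ) + 1) + 1 = 2 * m + 3 by ring, show (m : ℝ) + 1 + 1 = m + 2 by ring]
  generalize upX (m + 1) t = X
  generalize upY (m + 1) t = Y
  generalize rightT m (t + 1) = T1
  generalize rightT m t = T0
  generalize rightK m t = K
  have h1 : (t : ℝ) + (2 * m + 2) ≠ 0 := by positivity
  have h2 : (t : ℝ) + (2 * m + 3) ≠ 0 := by positivity
  field_simp
  ring

theorem ratDeg_rightT (m : ℕ) : RatDeg (m + 1 : ℕ) (rightT m) := by
  unfold rightT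
  refine RatDeg.sum _ (fun j => ?_) (by positivity)
  refine ((RatDeg.poch_add (-(j : ℝ)) (m + 1)).const_mul
    (((m + 1).choose j : ℝ) ^ 2 * ((2 * m + 1 + j).choose (m + 1) : ℝ)
      / (m + 1).factorial)).congr fun t _ => ?_
  rw [← sub_eq_add_neg]
  ring

theorem ratDeg_rightT_add_one_sub (m : ℕ) :
    RatDeg m fun t => rightT m (t + 1) - rightT m t := by
  unfold rightT
  simp only [← Finset.sum_sub_distrib]
  refine RatDeg.sum _ (fun j => ?_) (by positivity)
  refine ((RatDeg.poch_add (-(j : ℝ) + 1) m).const_mul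
    (((m + 1).choose j : ℝ) ^ 2 * ((2 * m + 1 + j).choose (m + 1) : ℝ)
      / (m + 1).factorial * (m + 1))).congr fun t _ => ?_
  rw [poch_succ_left (t - j), poch_succ_right (t + 1 - j),
    show t + 1 - (j : ℝ) = t + (-j + 1) by ring, show t - (j : ℝ) + 1 = t + (-j + 1) by ring]
  ring

theorem ratDeg_rightK (m : ℕ) : RatDeg (-(m + 4 : ℕ)) (rightK m) := by
  refine ((((RatDeg.poch_add (-m : ℝ) m).const_mul ((m + 1).factorial : ℝ)).mul
    (RatDeg.inv_poch_add le_rfl (m + 2))).mul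
    (RatDeg.inv_poch_add (Nat.cast_nonneg m) (m + 2))).mono (by push_cast; lia) |>.congr
    fun t _ => ?_
  rw [rightK, add_zero, ← sub_eq_add_neg]
  ring

theorem ratDeg_rightG (m : ℕ) : RatDeg (-(m + 4 : ℕ)) (rightG m) := by
  refine ((((RatDeg.poch_add (-(m + 1) : ℝ) m).const_mul ((m + 1).factorial : ℝ)).mul
    (RatDeg.inv_poch_add le_rfl (m + 2))).mul
    (RatDeg.inv_poch_add (Nat.cast_nonneg m) (m + 2))).mono (by push_cast; lia) |>.congr
    fun t _ => ?_
  rw [rightG, add_zero, ← sub_eq_add_neg]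
  ring

theorem ratDeg_Rtilde (m : ℕ) : RatDeg (-2) (Rtilde (m + 1) 1) := by
  refine ((((RatDeg.add_const (-(m + 1))).mul (ratDeg_rightK m)).mul
    (ratDeg_rightT m)).mono (by push_cast; lia)).congr fun t ht => ?_
  rw [Rtilde_succ_one m ht, ← sub_eq_add_neg]

theorem ratDeg_rightv (m : ℕ) : RatDeg (-2) (rightv m) := by
  have h : RatDeg 1 fun t => (12 * (m + 1 : ℝ) - 5) * t + (m + 1) * (12 * (m + 1) - 7) :=
    (RatDeg.id.const_mul _).add ((RatDeg.const _).mono (by norm_num))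
  exact (((ratDeg_rightK m).mul h).mul (ratDeg_rightT m)).mono (by push_cast; lia)

theorem ratDeg_rightF (m : ℕ) {A B : ℝ → ℝ} (hB : RatDeg 3 B)
    (hAB : RatDeg 4 fun t => A t + t ^ 2 * B t) : RatDeg 0 (rightF m A B) := by
  have h1 : RatDeg (m + 5 : ℕ) fun t => (A t + t ^ 2 * B t) * rightT m t :=
    (hAB.mul (ratDeg_rightT m)).mono (by push_cast; lia)
  have h2 : RatDeg (m + 5 : ℕ) fun t => t ^ 2 * B t * (rightT m (t + 1) - rightT m t) :=
    (((RatDeg.id.pow 2).mul hB).mul (ratDeg_rightT_add_one_sub m)).mono (by push_cast; lia)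
  refine ((((ratDeg_rightG m).mul (h1.add h2)).mul
    (RatDeg.inv_add_const (c := 2 * m + 2) (by positivity))).mono (by push_cast; lia)).congr
    fun t _ => ?_
  rw [rightF, div_eq_mul_inv]
  ring

theorem ratDeg_cubic (a b c d : ℝ) : RatDeg 3 fun t => -(a + b * t + c * t ^ 2 + d * t ^ 3) := by
  have h (c : ℝ) (k : ℕ) (hk : k ≤ 3) : RatDeg 3 fun t => c * t ^ k :=
    ((RatDeg.id.pow k).const_mul c).mono (by lia)
  exact ((((h a 0 (by norm_num)).add (h b 1 (by norm_num))).add (h c 2 (by norm_num))).add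
    (h d 3 (by norm_num)) |>.const_mul (-1)).congr fun t _ => by ring

theorem ratDeg_quintic_add_sq_mul_cubic (a₀ a₁ a₂ a₃ a₄ a₅ b₀ b₁ b₂ b₃ : ℝ) (h : a₅ + b₃ = 0) :
    RatDeg 4 fun t =>
      -(a₀ + a₁ * t + a₂ * t ^ 2 + a₃ * t ^ 3 + a₄ * t ^ 4 + a₅ * t ^ 5)
        + t ^ 2 * -(b₀ + b₁ * t + b₂ * t ^ 2 + b₃ * t ^ 3) := by
  have h' (c : ℝ) (k : ℕ) (hk : k ≤ 4) : RatDeg 4 fun t => c * t ^ k :=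
    ((RatDeg.id.pow k).const_mul c).mono (by lia)
  exact (((((h' a₀ 0 (by norm_num)).add (h' a₁ 1 (by norm_num))).add
    (h' (a₂ + b₀) 2 (by norm_num))).add (h' (a₃ + b₁) 3 (by norm_num))).add
    (h' (a₄ + b₂) 4 le_rfl) |>.const_mul (-1)).congr fun t _ => by
      linear_combination (-t ^ 5) * h

theorem ratDeg_rightF_certOne (m : ℕ) (n : ℝ) : RatDeg 0 (rightF m (certA1 n) (certB1 n)) := by
  refine ratDeg_rightF m (ratDeg_cubic _ _ _ _)
    (ratDeg_quintic_add_sq_mul_cubic _ _ _ _ _ _ _ _ _ _ ?_)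
  ring

theorem ratDeg_rightF_certTwo (m : ℕ) (n : ℝ) : RatDeg 0 (rightF m (certA2 n) (certB2 n)) := by
  refine ratDeg_rightF m (ratDeg_cubic _ _ _ _)
    (ratDeg_quintic_add_sq_mul_cubic _ _ _ _ _ _ _ _ _ _ ?_)
  ring

/-- Telescoping for the second derivatives, for a potential with a simple zero at `1`. -/
theorem hasSum_deriv_deriv_of_telescope {F E : ℝ → ℝ} (hF : RatDeg 0 F) (hE : RatDeg (-2) E)
    (h : ∀ t, 0 < t → E t = (t + 1 - 1) * F (t + 1) - (t - 1) * F t) :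
    HasSum (fun ν : ℕ => deriv (deriv E) (1 + (ν : ℝ))) (-(2 * deriv F 1)) := by
  have hV : RatDeg 1 fun t => (t - 1) * F t :=
    (((RatDeg.add_const (-1)).mul hF).mono (by norm_num)).congr fun t _ => by ring
  have hd : ∀ t, 0 < t → deriv E t
      = deriv (fun t => (t - 1) * F t) (t + 1) - deriv (fun t => (t - 1) * F t) t := by
    intro t ht
    have h1 : E =ᶠ[nhds t] fun s => (s + 1 - 1) * F (s + 1) - (s - 1) * F s := by
      filter_upwards [lt_mem_nhds ht] with s hs using h s hs
    rw [h1.deriv_eq, deriv_fun_sub (hV.comp_add_one.differentiableAt ht)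
      (hV.differentiableAt ht), deriv_comp_add_const (f := fun t => (t - 1) * F t)]
  have hs := hV.deriv.hasSum_deriv_of_telescope (hE.deriv.mono (by norm_num)) hd one_pos
  have hd1 : ∀ t, 0 < t → deriv (fun t => (t - 1) * F t) t = F t + (t - 1) * deriv F t := by
    intro t ht
    have := (((hasDerivAt_id t).sub_const 1).fun_mul (hF.differentiableAt ht).hasDerivAt).deriv
    simpa using this
  have h1 : deriv (fun t => (t - 1) * F t) =ᶠ[nhds 1] fun t => F t + (t - 1) * deriv F t := by
    filter_upwards [lt_mem_nhds (zero_lt_one' ℝ)] with t ht using hd1 t ht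
  rw [h1.deriv_eq, ((hF.differentiableAt one_pos).hasDerivAt.fun_add
    (hasDerivAt_sub_mul (hF.deriv.differentiableAt one_pos))).deriv, ← two_mul] at hs
  exact hs

/-- Comparison of first-order Taylor expansions at `1`. -/
theorem jet_eq {f g D N h : ℝ → ℝ} {D' N' : ℝ}
    (heq : ∀ t, 0 < t → f t * D t = g t * N t + (t - 1) ^ 2 * h t)
    (hf : DifferentiableAt ℝ f 1) (hg : DifferentiableAt ℝ g 1) (hh : DifferentiableAt ℝ h 1)
    (hD : HasDerivAt D D' 1) (hN : HasDerivAt N N' 1) :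
    f 1 * D 1 = g 1 * N 1 ∧ deriv f 1 * D 1 + f 1 * D' = deriv g 1 * N 1 + g 1 * N' := by
  refine ⟨by simpa using heq 1 one_pos, ?_⟩
  have h1 := hf.hasDerivAt.fun_mul hD
  have h2 := (hg.hasDerivAt.fun_mul hN).fun_add
    ((((hasDerivAt_id' (1 : ℝ)).sub_const 1).fun_pow 2).fun_mul hh.hasDerivAt)
  have h3 : (fun t => f t * D t) =ᶠ[nhds 1] fun t => g t * N t + (t - 1) ^ 2 * h t := by
    filter_upwards [lt_mem_nhds (zero_lt_one' ℝ)] with t ht using heq t ht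
  simpa using (h2.congr_of_eventuallyEq h3).unique h1 |>.symm

theorem hasDerivAt_cubic_one (a b c d : ℝ) :
    HasDerivAt (fun t : ℝ => a + b * t + c * t ^ 2 + d * t ^ 3) (b + 2 * c + 3 * d) 1 := by
  have h (c : ℝ) (k : ℕ) : HasDerivAt (fun t : ℝ => c * t ^ k) (c * k) 1 := by
    simpa using (hasDerivAt_pow k (1 : ℝ)).const_mul c
  have := (((h a 0).fun_add (h b 1)).fun_add (h c 2)).fun_add (h d 3)
  refine (this.congr_of_eventuallyEq (.of_forall fun t => by simp)).congr_deriv ?_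
  push_cast
  ring

theorem hasDerivAt_quintic_one (a b c d e f : ℝ) :
    HasDerivAt (fun t : ℝ => a + b * t + c * t ^ 2 + d * t ^ 3 + e * t ^ 4 + f * t ^ 5)
      (b + 2 * c + 3 * d + 4 * e + 5 * f) 1 := by
  have h (c : ℝ) (k : ℕ) : HasDerivAt (fun t : ℝ => c * t ^ k) (c * k) 1 := by
    simpa using (hasDerivAt_pow k (1 : ℝ)).const_mul c
  have := (((((h a 0).fun_add (h b 1)).fun_add (h c 2)).fun_add (h d 3)).fun_add (h e 4)).fun_add
    (h f 5)
  refine (this.congr_of_eventuallyEq (.of_forall fun t => by simp)).congr_deriv ?_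
  push_cast
  ring

theorem hasDerivAt_recP1_sub_one (n : ℝ) :
    HasDerivAt (fun t => recP1 n (t - 1)) (n ^ 2 - 3 * n - 1) 1 := by
  refine ((hasDerivAt_cubic_one (-2 * n ^ 3 - 2 * n ^ 2 - 2 * n + 1) (n ^ 2 + 5 * n - 3)
    (4 - 4 * n) (-2)).congr_of_eventuallyEq (.of_forall fun t => ?_)).congr_deriv ?_
  · simp only [recP1]
    ring
  · ring

theorem rightT_rec_sub_one (m : ℕ) (t : ℝ) :
    t ^ 2 * (t + m) * rightT m (t + 1) = -(recP1 (m + 1) (t - 1) * rightT m t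
      + (t - 1) ^ 2 * (t + (3 * m + 2)) * rightT m (t - 1)) := by
  have := rightT_rec m (t - 1)
  rw [show t - 1 + 2 = t + 1 by ring, sub_add_cancel] at this
  linear_combination this

theorem differentiable_rightT_sub_one (m : ℕ) : Differentiable ℝ fun t => rightT m (t - 1) := by
  unfold rightT poch
  fun_prop

theorem rightG_mul_rightT_jet (m : ℕ) :
    rightG m 1 * rightT m 1 = (-1) ^ m / (2 * (m + 1) ^ 2 * (m + 2)) ∧
      deriv (fun t => rightG m t * rightT m t) 1
        = (-1) ^ m / (2 * (m + 1) ^ 2 * (m + 2)) * (1 / (2 * (m + 1)) - 1 / (m + 2)) := by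
  have hφ : ∀ m, RatDeg (-3) fun t => rightG m t * rightT m t := fun m =>
    ((ratDeg_rightG m).mul (ratDeg_rightT m)).mono (by push_cast; lia)
  induction m with
  | zero =>
    have h (t : ℝ) (ht : 0 < t) :
        rightG 0 t * rightT 0 t * (t ^ 2 * (t + 1) ^ 2) = 1 * (3 * t - 2) + (t - 1) ^ 2 * 0 := by
      simp [rightG, rightT, poch, Finset.sum_range_succ, Finset.prod_range_succ]
      field_simp
      ring
    have hD : HasDerivAt (fun t : ℝ => t ^ 2 * (t + 1) ^ 2) 12 1 := by
      refine (((hasDerivAt_pow 2 (1 : ℝ)).fun_mul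
        (((hasDerivAt_id' (1 : ℝ)).add_const 1).fun_pow 2))).congr_deriv ?_
      norm_num
    have hN : HasDerivAt (fun t : ℝ => 3 * t - 2) 3 1 := by
      simpa using ((hasDerivAt_id' (1 : ℝ)).const_mul 3).sub_const 2
    obtain ⟨h1, h2⟩ := jet_eq (f := fun t => rightG 0 t * rightT 0 t) (g := fun _ => 1)
      (h := fun _ => 0) h ((hφ 0).differentiableAt one_pos) (by fun_prop) (by fun_prop) hD hN
    norm_num at h1 h2 ⊢
    constructor <;> linarith
  | succ m ih =>
    set n : ℝ := m + 1 with hn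
    have hpos : 0 < n := by positivity
    obtain ⟨X', hX', hX⟩ : ∃ X', X' = _ ∧ HasDerivAt (upX n) X' 1 :=
      ⟨_, rfl, ((hasDerivAt_cubic_one _ _ (-((((((171) * n + 210) * n + 45) * n - 30) * n
          - 14) * n - 2))
        (-(((((85) * n + 145) * n + 90) * n + 25) * n + 3))).congr_of_eventuallyEq
        (.of_forall fun t => by
          rw [upX, sub_eq_add_neg, sub_eq_add_neg, ← neg_mul, ← neg_mul]))⟩
    have hY : HasDerivAt (upY n) (((((85) * n + 145) * n + 90) * n + 25) * n + 3) 1 := by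
      exact (((hasDerivAt_id' (1 : ℝ)).const_mul _).const_add _).congr_deriv (mul_one _)
    have lin (c : ℝ) : HasDerivAt (fun t => t + c) 1 1 := (hasDerivAt_id' (1 : ℝ)).add_const c
    have hD := ((((lin (n + 1)).fun_mul (lin (2 * n))).fun_mul (lin (2 * n + 1))).const_mul
      (4 * (n + 1) ^ 3 * n ^ 2 * (2 * n + 1) ^ 2))
    have hN := ((lin (-(n + 1))).const_mul (n + 1)).fun_mul
      (((lin (n - 1)).fun_mul hX).fun_sub (hY.fun_mul (hasDerivAt_recP1_sub_one n)))
    have heq : ∀ t, 0 < t → rightG (m + 1) t * rightT (m + 1) t *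
        (4 * (n + 1) ^ 3 * n ^ 2 * (2 * n + 1) ^ 2 *
          ((t + (n + 1)) * (t + 2 * n) * (t + (2 * n + 1))))
        = rightG m t * rightT m t * ((n + 1) * (t + -(n + 1)) *
          ((t + (n - 1)) * upX n t - upY n t * recP1 n (t - 1))) + (t - 1) ^ 2 *
          (rightG m t * (-(n + 1) * (t + -(n + 1)) * upY n t * (t + (3 * n - 1)) *
            rightT m (t - 1))) := by
      intro t ht
      have h1 := rightT_up m t
      have h2 := rightT_rec_sub_one m t
      have h3 : rightG (m + 1) t * ((t + (n + 1)) * (t + 2 * n) * (t + (2 * n + 1)))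
          = rightG m t * ((n + 1) * (t - (n + 1)) * (t + (n - 1))) := by
        rw [rightG_succ m ht, show n + 1 = m + 2 by rw [hn]; ring,
          show 2 * n + 1 = 2 * m + 3 by rw [hn]; ring, show 2 * n = 2 * m + 2 by rw [hn]; ring,
          show n - 1 = m by rw [hn]; ring]
        field_simp
      rw [← hn] at h1 h2
      rw [show (m : ℝ) + 2 = n + 1 by rw [hn]; ring, show 2 * (m : ℝ) + 3 = 2 * n
          + 1 by rw [hn]; ring]
        at h1
      rw [show 3 * (m : ℝ) + 2 = 3 * n - 1 by rw [hn]; ring, show (m : ℝ) = n - 1 by rw [hn]; ring]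
        at h2
      linear_combination (4 * (n + 1) ^ 3 * n ^ 2 * (2 * n + 1) ^ 2 * rightT (m + 1) t) * h3
        + (rightG m t * ((n + 1) * (t - (n + 1)) * (t + (n - 1)))) * h1
        + (rightG m t * ((n + 1) * (t - (n + 1)) * upY n t)) * h2
    have hYd : DifferentiableAt ℝ (upY n) 1 := hY.differentiableAt
    have hTd := (differentiable_rightT_sub_one m) 1
    have hGd := (ratDeg_rightG m).differentiableAt one_pos
    obtain ⟨h1, h2⟩ := jet_eq (f := fun t => rightG (m + 1) t * rightT (m + 1) t)
      (g := fun t => rightG m t * rightT m t) heq ((hφ _).differentiableAt one_pos)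
      ((hφ _).differentiableAt one_pos) (by fun_prop) hD hN
    rw [ih.2, sub_self] at h2
    rw [sub_self] at h1
    rw [ih.1] at h1 h2
    rw [show (m : ℝ) + 2 = n + 1 by rw [hn]; ring] at h1 h2
    rw [show ((m + 1 : ℕ) : ℝ) + 1 = n + 1 by rw [hn]; push_cast; ring,
      show ((m + 1 : ℕ) : ℝ) + 2 = n + 2 by rw [hn]; push_cast; ring, pow_succ]
    have hd1 : 4 * (n + 1) ^ 3 * n ^ 2 * (2 * n + 1) ^ 2 *
        ((1 + (n + 1)) * (1 + 2 * n) * (1 + (2 * n + 1))) ≠ 0 := by positivity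
    generalize (-1 : ℝ) ^ m = s at *
    have h1' : rightG (m + 1) 1 * rightT (m + 1) 1 = s * -1 / (2 * (n + 1) ^ 2 * (n + 2)) := by
      refine mul_right_cancel₀ hd1 (h1.trans ?_)
      simp only [upX, upY, recP1]
      field_simp
      ring
    refine ⟨h1', ?_⟩
    rw [h1'] at h2
    refine mul_right_cancel₀ hd1 ((eq_sub_of_add_eq h2).trans ?_)
    simp only [hX', upX, upY, recP1]
    field_simp
    ring

theorem deriv_rightF_one (m : ℕ) {A B : ℝ → ℝ} {A' B' : ℝ} (hF : RatDeg 0 (rightF m A B))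
    (hA : HasDerivAt A A' 1) (hB : HasDerivAt B B' 1) {n : ℝ} (hn : n = m + 1) :
    2 * deriv (rightF m A B) 1 * (n * (2 * n + 1)) ^ 2 * (2 * n ^ 2 * (n + 1) ^ 2)
      = (-1) ^ m * ((A 1 + B 1 * (2 * n ^ 2 + n + 1)) * n * ((1 - n) * (2 * n + 1)
          - 2 * (n + 1) * (3 * n + 1))
        + 2 * n * (2 * n + 1) * (n + 1) * (A 1 + A' * n + B' * n * (2 * n ^ 2 + n + 1)
          - B 1 * (n ^ 2 - 3 * n - 1))) := by
  have lin (c : ℝ) : HasDerivAt (fun t => t + c) 1 1 := (hasDerivAt_id' (1 : ℝ)).add_const c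
  have hD := (lin (n - 1)).fun_mul (lin (2 * n))
  have hN := (hA.fun_mul (lin (n - 1))).fun_sub (hB.fun_mul (hasDerivAt_recP1_sub_one n))
  have heq : ∀ t, 0 < t → rightF m A B t * ((t + (n - 1)) * (t + 2 * n))
      = rightG m t * rightT m t * (A t * (t + (n - 1)) - B t * recP1 n (t - 1))
        + (t - 1) ^ 2 * (rightG m t * (-(B t) * (t + (3 * n - 1)) * rightT m (t - 1))) := by
    intro t ht
    have h2 := rightT_rec_sub_one m t
    rw [← hn, show 3 * (m : ℝ) + 2 = 3 * n - 1 by rw [hn]; ring,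
      show (m : ℝ) = n - 1 by rw [hn]; ring] at h2
    have h3 : rightF m A B t * (t + 2 * n)
        = rightG m t * (A t * rightT m t + t ^ 2 * B t * rightT m (t + 1)) := by
      rw [rightF, show 2 * n = 2 * m + 2 by rw [hn]; ring]
      field_simp
    linear_combination (t + (n - 1)) * h3 + rightG m t * B t * h2
  have hTd := (differentiable_rightT_sub_one m) 1
  have hGd := (ratDeg_rightG m).differentiableAt one_pos
  have hBd := hB.differentiableAt
  have hφ : RatDeg (-3) fun t => rightG m t * rightT m t :=
    ((ratDeg_rightG m).mul (ratDeg_rightT m)).mono (by push_cast; lia)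
  obtain ⟨h1, h2⟩ := jet_eq (f := rightF m A B) (g := fun t => rightG m t * rightT m t) heq
    (hF.differentiableAt one_pos) (hφ.differentiableAt one_pos) (by fun_prop) hD hN
  obtain ⟨j1, j2⟩ := rightG_mul_rightT_jet m
  rw [j2] at h2
  rw [j1] at h1 h2
  have hpos : 0 < n := by rw [hn]; positivity
  rw [show (m : ℝ) + 2 = n + 1 by rw [hn]; ring, ← hn, sub_self, add_sub_cancel] at h1 h2
  have hP : recP1 n 0 = -n * (2 * n ^ 2 + n + 1) := by
    rw [recP1]
    ring
  rw [hP] at h1 h2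
  generalize (-1 : ℝ) ^ m = s at *
  generalize deriv (rightF m A B) 1 = x at *
  generalize rightF m A B 1 = y at *
  have h1' := eq_div_of_mul_eq (by positivity) h1
  rw [h1'] at h2
  have h2' := eq_div_of_mul_eq (show n * (1 + 2 * n) ≠ 0 by positivity) (eq_sub_of_add_eq h2)
  rw [h2', add_comm 1 (2 * n)]
  field_simp
  ring

theorem deriv_rightF_certOne_one (m : ℕ) :
    2 * deriv (rightF m (certA1 (m + 1)) (certB1 (m + 1))) 1
      = (-1) ^ (m + 1) * 12 * rightNum (m + 1) := by
  obtain ⟨n, hn⟩ : ∃ n : ℝ, n = m + 1 := ⟨_, rfl⟩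
  rw [← hn]
  have hpos : 0 < n := by rw [hn]; positivity
  obtain ⟨A', hA', hA⟩ : ∃ A', A' = _ ∧ HasDerivAt (certA1 n) A' 1 :=
    ⟨_, rfl, (hasDerivAt_quintic_one _ _ _ _ _ _).fun_neg⟩
  obtain ⟨B', hB', hB⟩ : ∃ B', B' = _ ∧ HasDerivAt (certB1 n) B' 1 :=
    ⟨_, rfl, (hasDerivAt_cubic_one _ _ _ _).fun_neg⟩
  refine mul_right_cancel₀ (b := (n * (2 * n + 1)) ^ 2 * (2 * n ^ 2 * (n + 1) ^ 2))
    (by positivity) ?_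
  rw [← mul_assoc, deriv_rightF_one m (ratDeg_rightF_certOne m n) hA hB hn, pow_succ]
  simp only [hA', hB', certA1, certB1, rightNum]
  ring

theorem deriv_rightF_certTwo_one (m : ℕ) {n : ℝ} (hn : n = m + 1) :
    2 * deriv (rightF m (certA2 n) (certB2 n)) 1
      = (-1) ^ (m + 1) * 12 * n ^ 2 * (8 * (2 * n + 1) ^ 5
        - (n + 1) ^ 3 * (4 * n + 1) * (4 * n + 3)) := by
  have hpos : 0 < n := by rw [hn]; positivity
  obtain ⟨A', hA', hA⟩ : ∃ A', A' = _ ∧ HasDerivAt (certA2 n) A' 1 :=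
    ⟨_, rfl, (hasDerivAt_quintic_one _ _ _ _ _ _).fun_neg⟩
  obtain ⟨B', hB', hB⟩ : ∃ B', B' = _ ∧ HasDerivAt (certB2 n) B' 1 :=
    ⟨_, rfl, (hasDerivAt_cubic_one _ _ _ _).fun_neg⟩
  refine mul_right_cancel₀ (b := (n * (2 * n + 1)) ^ 2 * (2 * n ^ 2 * (n + 1) ^ 2))
    (by positivity) ?_
  rw [← mul_assoc, deriv_rightF_one m (ratDeg_rightF_certTwo m n) hA hB hn, pow_succ]
  simp only [hA', hB', certA2, certB2]
  ring

/-- The sum of the second derivatives over the positive integers. -/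
noncomputable def derivDerivSum (f : ℝ → ℝ) : ℝ := ∑' ν : ℕ, deriv (deriv f) (1 + (ν : ℝ))

theorem derivDerivSum_linear {f g : ℝ → ℝ} (hf : RatDeg (-2) f) (hg : RatDeg (-2) g) (a b : ℝ) :
    derivDerivSum (fun t => a * f t + b * g t) = a * derivDerivSum f + b * derivDerivSum g := by
  have h1 : ∀ t, 0 < t → deriv (fun t => a * f t + b * g t) t = a * deriv f t + b * deriv g t := by
    intro t ht
    rw [deriv_fun_add ((hf.const_mul a).differentiableAt ht) ((hg.const_mul b).differentiableAt ht),
      deriv_const_mul_field, deriv_const_mul_field]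
  have h2 : ∀ t, 0 < t → deriv (deriv fun t => a * f t + b * g t) t
      = a * deriv (deriv f) t + b * deriv (deriv g) t := by
    intro t ht
    have h : deriv (fun t => a * f t + b * g t) =ᶠ[nhds t] fun t => a * deriv f t
        + b * deriv g t := by
      filter_upwards [lt_mem_nhds ht] with s hs using h1 s hs
    rw [h.deriv_eq, deriv_fun_add ((hf.deriv.const_mul a).differentiableAt ht)
      ((hg.deriv.const_mul b).differentiableAt ht), deriv_const_mul_field, deriv_const_mul_field]
  unfold derivDerivSum
  rw [← tsum_mul_left, ← tsum_mul_left, ← ((hf.deriv.deriv.summable (by norm_num) 1).mul_left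
    a).tsum_add ((hg.deriv.deriv.summable (by norm_num) 1).mul_left b)]
  exact tsum_congr fun ν => h2 _ (by positivity)

theorem derivDerivSum_rightv_zero : derivDerivSum (rightv 0) = -18 := by
  have hF : RatDeg (-1) fun t => (t + 0)⁻¹ * 11 + (t + 0)⁻¹ ^ 2 * (-10) :=
    ((RatDeg.inv_add_const le_rfl).mul (RatDeg.const 11)).add
      ((((RatDeg.inv_add_const le_rfl).pow 2).mul (RatDeg.const (-10))).mono (by norm_num))
  have h : ∀ t, 0 < t → rightv 0 t = (t + 1 - 1) * ((t + 1 + 0)⁻¹ * 11 + (t + 1 + 0)⁻¹ ^ 2 * (-10))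
      - (t - 1) * ((t + 0)⁻¹ * 11 + (t + 0)⁻¹ ^ 2 * (-10)) := by
    intro t ht
    simp [rightv, rightK, rightT, poch, Finset.sum_range_succ, Finset.prod_range_succ]
    field_simp
    ring
  rw [derivDerivSum, (hasSum_deriv_deriv_of_telescope (hF.mono (by norm_num)) (ratDeg_rightv 0)
    h).tsum_eq]
  have hi : HasDerivAt (fun t : ℝ => (t + 0)⁻¹) (-1) 1 := by
    simpa using hasDerivAt_inv (one_ne_zero (α := ℝ))
  rw [((hi.mul_const 11).fun_add ((hi.fun_pow 2).mul_const (-10))).deriv]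
  norm_num

theorem derivDerivSum_rightv_rec (m : ℕ) {n : ℝ} (hn : n = m + 1) :
    8 * n ^ 2 * (n + 1) ^ 3 * (2 * n + 1) ^ 5 * derivDerivSum (rightv (m + 1))
      + n ^ 5 * (n + 1) ^ 3 * (4 * n + 1) * (4 * n + 3) * derivDerivSum (rightv m)
    = (-1) ^ m * 12 * n ^ 2 * (8 * (2 * n + 1) ^ 5 - (n + 1) ^ 3 * (4 * n + 1) * (4 * n + 3)) := by
  have h := @rightv_telescope m
  rw [← hn, show (m : ℝ) + 2 = n + 1 by rw [hn]; ring, show 2 * (m : ℝ) + 3 = 2 * n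
      + 1 by rw [hn]; ring,
    show 4 * (m : ℝ) + 5 = 4 * n + 1 by rw [hn]; ring,
    show 4 * (m : ℝ) + 7 = 4 * n + 3 by rw [hn]; ring] at h
  have h1 := (hasSum_deriv_deriv_of_telescope (ratDeg_rightF_certTwo m n)
    (((ratDeg_rightv (m + 1)).const_mul _).add ((ratDeg_rightv m).const_mul _))
    fun _ ht => h ht).tsum_eq
  have h2 := derivDerivSum_linear (ratDeg_rightv (m + 1)) (ratDeg_rightv m)
    (8 * n ^ 2 * (n + 1) ^ 3 * (2 * n + 1) ^ 5)
    (n ^ 5 * (n + 1) ^ 3 * (4 * n + 1) * (4 * n + 3))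
  rw [← h2, derivDerivSum, h1, deriv_rightF_certTwo_one m hn]
  ring

theorem derivDerivSum_rightv (m : ℕ) :
    derivDerivSum (rightv m) = (-1) ^ (m + 1) * (16 * ((m + 1).factorial : ℝ) ^ 8
      * (4 * m + 4).factorial / ((m + 1) ^ 3 * (2 * m + 2).factorial ^ 6) + 12 / (m + 1) ^ 3) := by
  induction m with
  | zero =>
    rw [derivDerivSum_rightv_zero]
    norm_num [Nat.factorial]
  | succ m ih =>
    obtain ⟨n, hn⟩ : ∃ n : ℝ, n = m + 1 := ⟨_, rfl⟩
    have hpos : 0 < n := by rw [hn]; positivity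
    have h := derivDerivSum_rightv_rec m hn
    rw [ih, ← hn, pow_succ (-1 : ℝ)] at h
    have h4 : ((4 * (m + 1) + 4).factorial : ℝ)
        = (4 * n + 4) * (4 * n + 3) * (4 * n + 2) * (4 * n + 1) * (4 * m + 4).factorial := by
      rw [show 4 * (m + 1) + 4 = 4 * m + 4 + 1 + 1 + 1 + 1 by ring, Nat.factorial_succ,
        Nat.factorial_succ, Nat.factorial_succ, Nat.factorial_succ, hn]
      push_cast
      ring
    have h2 : ((2 * (m + 1) + 2).factorial : ℝ)
        = (2 * n + 2) * (2 * n + 1) * (2 * m + 2).factorial := by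
      rw [show 2 * (m + 1) + 2 = 2 * m + 2 + 1 + 1 by ring, Nat.factorial_succ,
        Nat.factorial_succ, hn]
      push_cast
      ring
    rw [h4, h2, Nat.factorial_succ (m + 1), pow_succ (-1 : ℝ), pow_succ (-1 : ℝ)]
    push_cast
    rw [← hn]
    have p1 : ((m + 1).factorial : ℝ) ≠ 0 := by positivity
    have p2 : ((2 * m + 2).factorial : ℝ) ≠ 0 := by positivity
    have p4 : ((4 * m + 4).factorial : ℝ) ≠ 0 := by positivity
    generalize ((m + 1).factorial : ℝ) = a at *
    generalize ((2 * m + 2).factorial : ℝ) = b at *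
    generalize ((4 * m + 4).factorial : ℝ) = c at *
    generalize (-1 : ℝ) ^ m = s at *
    have hc : 8 * n ^ 2 * (n + 1) ^ 3 * (2 * n + 1) ^ 5 ≠ 0 := by positivity
    refine mul_left_cancel₀ hc ((eq_sub_of_add_eq h).trans ?_)
    field_simp
    ring

theorem Zr_rec (m : ℕ) :
    Zr (m + 2) 1 + recCoeff (m + 1) * Zr (m + 1) 1 = 1 / 3 * deriv (leftV m) (m + 2) := by
  have h1 := (hasSum_deriv_deriv_of_telescope (ratDeg_rightF_certOne m (m + 1))
    (((((ratDeg_Rtilde (m + 1)).add ((ratDeg_Rtilde m).const_mul _)).const_mul _).sub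
      ((ratDeg_rightv m).const_mul _))) fun t ht => Rtilde_telescope m ht).tsum_eq
  have h2 := derivDerivSum_linear (ratDeg_Rtilde (m + 1)) (ratDeg_Rtilde m) 1 (recCoeff (m + 1))
  have h3 := derivDerivSum_linear
    ((ratDeg_Rtilde (m + 1)).add ((ratDeg_Rtilde m).const_mul (recCoeff (m + 1))))
    (ratDeg_rightv m) (8 * ((m : ℝ) + 1) ^ 4 * (m + 2) ^ 3 * (2 * m + 3) ^ 5)
    (-((m + 1) ^ 3 * rightNum (m + 1)))
  simp only [one_mul] at h2
  simp only [neg_mul, ← sub_eq_add_neg] at h3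
  rw [h2] at h3
  have key := h3.symm.trans h1
  rw [derivDerivSum_rightv, deriv_rightF_certOne_one] at key
  rw [deriv_leftV]
  change 1 / 6 * derivDerivSum (Rtilde (m + 1 + 1) 1)
    + recCoeff (m + 1) * (1 / 6 * derivDerivSum (Rtilde (m + 1) 1)) = _
  have hc : 8 * ((m : ℝ) + 1) ^ 4 * (m + 2) ^ 3 * (2 * m + 3) ^ 5 ≠ 0 := by positivity
  refine mul_left_cancel₀ hc ?_
  have p2 : ((2 * m + 2).factorial : ℝ) ≠ 0 := by positivity
  generalize derivDerivSum (Rtilde (m + 1 + 1) 1) = x at *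
  generalize derivDerivSum (Rtilde (m + 1) 1) = y at *
  generalize recCoeff (m + 1) = r at *
  generalize rightNum (m + 1) = d at *
  generalize ((m + 1).factorial : ℝ) = a at *
  generalize ((2 * m + 2).factorial : ℝ) = b at *
  generalize ((4 * m + 4).factorial : ℝ) = c at *
  generalize (-1 : ℝ) ^ (m + 1) = s at *
  have key' := sub_eq_iff_eq_add.1 key
  rw [show 8 * ((m : ℝ) + 1) ^ 4 * (m + 2) ^ 3 * (2 * m + 3) ^ 5 * (1 / 6 * x + r * (1 / 6 * y))
    = 1 / 6 * (8 * ((m : ℝ) + 1) ^ 4 * (m + 2) ^ 3 * (2 * m + 3) ^ 5 * (x + r * y)) by ring, key']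
  field_simp
  ring

theorem Zl_one_one_eq_Zr_one_one : Zl 1 1 = Zr 1 1 := by
  have hR := ratDeg_R 0
  have hT := ratDeg_Rtilde 0
  have hG : RatDeg (-2) fun t => ((t + 0)⁻¹ ^ 2 * (t + -1)) ^ 2 * 4 :=
    ((((((RatDeg.inv_add_const le_rfl).pow 2).mul (RatDeg.add_const (-1))).pow 2).mul
      (RatDeg.const 4))).mono (by norm_num)
  have hE : RatDeg (-3) fun t => 2 * R 1 1 t + deriv (Rtilde 1 1) t :=
    (hR.const_mul 2).add hT.deriv
  have hRt : ∀ t, 0 < t → Rtilde 1 1 t = (t - 1) * (3 * t - 2) / (t ^ 2 * (t + 1) ^ 2) := by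
    intro t ht
    rw [Rtilde_succ_one 0 ht]
    simp [rightK, rightT, poch, Finset.sum_range_succ, Finset.prod_range_succ]
    field_simp
    ring
  have hRt' : ∀ t, 0 < t → deriv (Rtilde 1 1) t
      = ((6 * t - 5) * (t ^ 2 * (t + 1) ^ 2) - (t - 1) * (3 * t - 2)
        * (2 * t * (t + 1) ^ 2 + t ^ 2 * (2 * (t + 1)))) / (t ^ 2 * (t + 1) ^ 2) ^ 2 := by
    intro t ht
    have h : Rtilde 1 1 =ᶠ[nhds t] fun t => (t - 1) * (3 * t - 2) / (t ^ 2 * (t + 1) ^ 2) := by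
      filter_upwards [lt_mem_nhds ht] with s hs using hRt s hs
    have i := hasDerivAt_id' t
    have hn := (i.sub_const 1).fun_mul ((i.const_mul 3).sub_const 2)
    have hd := (i.fun_pow 2).fun_mul ((i.add_const 1).fun_pow 2)
    rw [h.deriv_eq, (hn.fun_div hd (by positivity)).deriv]
    norm_num
    ring
  have htel : ∀ t, 0 < t → 2 * R 1 1 t + deriv (Rtilde 1 1) t
      = ((t + 1 + 0)⁻¹ ^ 2 * (t + 1 + -1)) ^ 2 * 4 - ((t + 0)⁻¹ ^ 2 * (t + -1)) ^ 2 * 4 := by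
    intro t ht
    have := R_succ_one 0 ht
    rw [hRt' t ht, this]
    simp [leftC, poch, Finset.prod_range_succ]
    field_simp
    ring
  have key := ((hG.mono (by norm_num)).hasSum_deriv_of_telescope (hE.mono (by norm_num)) htel
    one_pos).tsum_eq
  have hG' : deriv (fun t : ℝ => ((t + 0)⁻¹ ^ 2 * (t + -1)) ^ 2 * 4) 1 = 0 := by
    have hi : HasDerivAt (fun t : ℝ => (t + 0)⁻¹) (-1) 1 := by
      simpa using hasDerivAt_inv (one_ne_zero (α := ℝ))
    rw [((((hi.fun_pow 2).fun_mul ((hasDerivAt_id' 1).add_const (-1))).fun_pow 2).mul_const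
      4).deriv]
    norm_num
  have hd : ∀ ν : ℕ, deriv (fun t => 2 * R 1 1 t + deriv (Rtilde 1 1) t) (1 + (ν : ℝ))
      = 2 * deriv (R 1 1) (1 + ν) + deriv (deriv (Rtilde 1 1)) (1 + ν) := by
    intro ν
    have hν : (0 : ℝ) < 1 + ν := by positivity
    rw [deriv_fun_add ((hR.const_mul 2).differentiableAt hν) (hT.deriv.differentiableAt hν),
      deriv_const_mul_field]
  rw [hG'] at key
  simp only [hd] at key
  rw [((hR.deriv.summable (by norm_num) 1).mul_left 2).tsum_add
    (hT.deriv.deriv.summable (by norm_num) 1), tsum_mul_left] at key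
  rw [Zl, Zr, sub_self, zero_add]
  linear_combination (-1 / 6) * key

/-- For all integers `n ≥ 1`, `Z_l(n,1) = Z_r(n,1)`. -/
theorem Zl_eq_Zr_at_m_one (n : ℕ) (hn : 1 ≤ n) : Zl n 1 = Zr n 1 := by
  induction n, hn using Nat.le_induction with
  | base => exact Zl_one_one_eq_Zr_one_one
  | succ n hn ih =>
    obtain ⟨m, rfl⟩ := Nat.exists_eq_add_of_le' hn
    have h1 := Zl_rec m
    have h2 := Zr_rec m
    rw [ih] at h1
    exact add_right_cancel (h1.trans h2.symm)
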